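/- arXiv:0706.1920 — 7 statements merged into one kernel-verified Lean document; each statement's English description precedes it below -/
import Mathlib

section
/- For every real number β with 0 < β < 1/5 there exists N such that for all n ≥ N the following holds: every (simple) graph G on n vertices with at least n^{2-β} edges contains a subgraph G' with at least (1/64)·n^{2-2β} edges such that every pair of edges of G' lies together on a cycle of G' of length at most 8, and moreover every pair of edges of G' sharing a vertex lies together on a cycle of G' of length at most 6. -/
namespace SimpleGraph
variable {V : Type*}

/-- Two edges lie together on a cycle of length at most `k`. -/
def EdgesOnCycle (H : SimpleGraph V) (k : ℕ) (e₁ e₂ : Sym2 V) : Prop :=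
  ∃ (v : V) (c : H.Walk v v), c.IsCycle ∧ c.length ≤ k ∧ e₁ ∈ c.edges ∧ e₂ ∈ c.edges

variable {H : SimpleGraph V}

theorem EdgesOnCycle.symm {k : ℕ} {e₁ e₂ : Sym2 V} (h : H.EdgesOnCycle k e₁ e₂) :
    H.EdgesOnCycle k e₂ e₁ :=
  let ⟨v, c, hc, hl, h₁, h₂⟩ := h
  ⟨v, c, hc, hl, h₂, h₁⟩

theorem EdgesOnCycle.mono {k l : ℕ} {e₁ e₂ : Sym2 V} (hkl : k ≤ l)
    (h : H.EdgesOnCycle k e₁ e₂) : H.EdgesOnCycle l e₁ e₂ :=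
  let ⟨v, c, hc, hl, h₁, h₂⟩ := h
  ⟨v, c, hc, hl.trans hkl, h₁, h₂⟩

theorem edgesOnCycle_of_four {a b c d : V} {e₁ e₂ : Sym2 V}
    (hab : H.Adj a b) (hbc : H.Adj b c) (hcd : H.Adj c d) (hda : H.Adj d a)
    (hn : [a, b, c, d].Nodup)
    (h₁ : e₁ ∈ [s(a, b), s(b, c), s(c, d), s(d, a)])
    (h₂ : e₂ ∈ [s(a, b), s(b, c), s(c, d), s(d, a)]) : H.EdgesOnCycle 4 e₁ e₂ := by
  refine ⟨a, .cons hab (.cons hbc (.cons hcd (.cons hda .nil))), ?_, by simp, by simpa using h₁,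
    by simpa using h₂⟩
  simp at hn
  simp [Walk.cons_isCycle_iff, Walk.cons_isPath_iff]
  grind

theorem edgesOnCycle_of_six {a b c d e f : V} {e₁ e₂ : Sym2 V}
    (hab : H.Adj a b) (hbc : H.Adj b c) (hcd : H.Adj c d) (hde : H.Adj d e) (hef : H.Adj e f)
    (hfa : H.Adj f a) (hn : [a, b, c, d, e, f].Nodup)
    (h₁ : e₁ ∈ [s(a, b), s(b, c), s(c, d), s(d, e), s(e, f), s(f, a)])
    (h₂ : e₂ ∈ [s(a, b), s(b, c), s(c, d), s(d, e), s(e, f), s(f, a)]) :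
    H.EdgesOnCycle 6 e₁ e₂ := by
  refine ⟨a, .cons hab (.cons hbc (.cons hcd (.cons hde (.cons hef (.cons hfa .nil))))), ?_,
    by simp, by simpa using h₁, by simpa using h₂⟩
  simp at hn
  simp [Walk.cons_isCycle_iff, Walk.cons_isPath_iff]
  grind

theorem edgesOnCycle_of_eight {a b c d e f g h : V} {e₁ e₂ : Sym2 V}
    (hab : H.Adj a b) (hbc : H.Adj b c) (hcd : H.Adj c d) (hde : H.Adj d e) (hef : H.Adj e f)
    (hfg : H.Adj f g) (hgh : H.Adj g h) (hha : H.Adj h a) (hn : [a, b, c, d, e, f, g, h].Nodup)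
    (h₁ : e₁ ∈ [s(a, b), s(b, c), s(c, d), s(d, e), s(e, f), s(f, g), s(g, h), s(h, a)])
    (h₂ : e₂ ∈ [s(a, b), s(b, c), s(c, d), s(d, e), s(e, f), s(f, g), s(g, h), s(h, a)]) :
    H.EdgesOnCycle 8 e₁ e₂ := by
  refine ⟨a, .cons hab (.cons hbc (.cons hcd (.cons hde (.cons hef (.cons hfg (.cons hgh
    (.cons hha .nil))))))), ?_, by simp, by simpa using h₁, by simpa using h₂⟩
  simp at hn
  simp [Walk.cons_isCycle_iff, Walk.cons_isPath_iff]
  grind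

/-- A bipartite relation `E` oriented from left to right vertices, with a right vertex `v` joined to
every left vertex, a left vertex `z` joined to every right vertex that is not `heavy`, and
robustly many paths of length three from each left vertex to each heavy vertex. -/
structure HubSystem (E : V → V → Prop) (heavy : V → Prop) (v z : V) : Prop where
  ne : ∀ {u y u' y'}, E u y → E u' y' → u ≠ y'
  hub_right : ∀ {u y}, E u y → E u v
  hub_left : ∀ {u y}, E u y → ¬ heavy y → E z y
  heavy_hub : heavy v
  edge : E z v
  exists_ne : ∀ {u y}, E u y → ∃ w, E w y ∧ w ≠ u
  path : ∀ {u y w a}, E u y → E w a → heavy a → ∀ F : Finset V, F.card ≤ 6 →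
    ∃ x u', E u x ∧ E u' x ∧ E u' a ∧ x ∉ F ∧ u' ∉ F
  common : ∀ {u y}, E u y → u ≠ z → ∀ F : Finset V, F.card ≤ 6 → ∃ x, E u x ∧ E z x ∧ x ∉ F

namespace HubSystem

variable {E : V → V → Prop} {heavy : V → Prop} {v z : V}

theorem four (h : HubSystem E heavy v z) (hE : ∀ u y, E u y → H.Adj u y)
    {a b c d : V} {e₁ e₂ : Sym2 V} (h₁ : E a b) (h₂ : E c b) (h₃ : E c d) (h₄ : E a d)
    (hac : a ≠ c) (hbd : b ≠ d)
    (he₁ : e₁ ∈ [s(a, b), s(c, b), s(c, d), s(a, d)])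
    (he₂ : e₂ ∈ [s(a, b), s(c, b), s(c, d), s(a, d)]) : H.EdgesOnCycle 6 e₁ e₂ := by
  have hne := @h.ne
  refine (edgesOnCycle_of_four (hE _ _ h₁) (hE _ _ h₂).symm (hE _ _ h₃) (hE _ _ h₄).symm ?_
    ?_ ?_).mono (by norm_num)
  · grind
  · simpa only [Sym2.eq_swap (a := b), Sym2.eq_swap (a := d)] using he₁
  · simpa only [Sym2.eq_swap (a := b), Sym2.eq_swap (a := d)] using he₂

theorem six (h : HubSystem E heavy v z) (hE : ∀ u y, E u y → H.Adj u y)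
    {a b c d e f : V} {e₁ e₂ : Sym2 V} (h₁ : E a b) (h₂ : E c b) (h₃ : E c d) (h₄ : E e d)
    (h₅ : E e f) (h₆ : E a f) (hn : [a, c, e].Nodup) (hn' : [b, d, f].Nodup)
    (he₁ : e₁ ∈ [s(a, b), s(c, b), s(c, d), s(e, d), s(e, f), s(a, f)])
    (he₂ : e₂ ∈ [s(a, b), s(c, b), s(c, d), s(e, d), s(e, f), s(a, f)]) :
    H.EdgesOnCycle 6 e₁ e₂ := by
  have hne := @h.ne
  refine edgesOnCycle_of_six (hE _ _ h₁) (hE _ _ h₂).symm (hE _ _ h₃) (hE _ _ h₄).symm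
    (hE _ _ h₅) (hE _ _ h₆).symm ?_ ?_ ?_
  · grind
  · simpa only [Sym2.eq_swap (a := b), Sym2.eq_swap (a := d), Sym2.eq_swap (a := f)] using he₁
  · simpa only [Sym2.eq_swap (a := b), Sym2.eq_swap (a := d), Sym2.eq_swap (a := f)] using he₂

theorem eight (h : HubSystem E heavy v z) (hE : ∀ u y, E u y → H.Adj u y)
    {a b c d e f g k : V} {e₁ e₂ : Sym2 V} (h₁ : E a b) (h₂ : E c b) (h₃ : E c d) (h₄ : E e d)
    (h₅ : E e f) (h₆ : E g f) (h₇ : E g k) (h₈ : E a k)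
    (hn : [a, c, e, g].Nodup) (hn' : [b, d, f, k].Nodup)
    (he₁ : e₁ ∈ [s(a, b), s(c, b), s(c, d), s(e, d), s(e, f), s(g, f), s(g, k), s(a, k)])
    (he₂ : e₂ ∈ [s(a, b), s(c, b), s(c, d), s(e, d), s(e, f), s(g, f), s(g, k), s(a, k)]) :
    H.EdgesOnCycle 8 e₁ e₂ := by
  have hne := @h.ne
  refine edgesOnCycle_of_eight (hE _ _ h₁) (hE _ _ h₂).symm (hE _ _ h₃) (hE _ _ h₄).symm
    (hE _ _ h₅) (hE _ _ h₆).symm (hE _ _ h₇) (hE _ _ h₈).symm ?_ ?_ ?_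
  · grind
  · simpa only [Sym2.eq_swap (a := b), Sym2.eq_swap (a := d), Sym2.eq_swap (a := f),
      Sym2.eq_swap (a := k)] using he₁
  · simpa only [Sym2.eq_swap (a := b), Sym2.eq_swap (a := d), Sym2.eq_swap (a := f),
      Sym2.eq_swap (a := k)] using he₂

open Classical in
theorem common_right (h : HubSystem E heavy v z) (hE : ∀ u y, E u y → H.Adj u y)
    {u₁ u₂ y : V} (h₁ : E u₁ y) (h₂ : E u₂ y) (hu : u₁ ≠ u₂) :
    H.EdgesOnCycle 6 s(u₁, y) s(u₂, y) := by
  by_cases hy : y = v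
  · subst hy
    have key : ∀ u, E u y → u ≠ z → H.EdgesOnCycle 6 s(u, y) s(z, y) := by
      intro u hu huz
      obtain ⟨x, hux, hzx, hxF⟩ := h.common hu huz {y} (by simp)
      exact h.four hE hu h.edge hzx hux huz (by grind) (by simp) (by simp)
    by_cases hz₁ : u₁ = z
    · subst hz₁
      exact (key u₂ h₂ hu.symm).symm
    by_cases hz₂ : u₂ = z
    · subst hz₂
      exact key u₁ h₁ hu
    obtain ⟨x, hux, hzx, hxF⟩ := h.common h₁ hz₁ {y} (by simp)
    obtain ⟨x', hux', hzx', hxF'⟩ := h.common h₂ hz₂ {y, x} (Finset.card_le_two.trans (by simp))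
    exact h.six hE h₁ h₂ hux' hzx' hzx hux (by grind) (by grind) (by simp) (by simp)
  · exact h.four hE h₁ h₂ (h.hub_right h₂) (h.hub_right h₁) hu hy (by simp) (by simp)

open Classical in
theorem common_left (h : HubSystem E heavy v z) (hE : ∀ u y, E u y → H.Adj u y)
    {u y₁ y₂ : V} (h₁ : E u y₁) (h₂ : E u y₂) (hy : y₁ ≠ y₂) :
    H.EdgesOnCycle 6 s(u, y₁) s(u, y₂) := by
  have key : ∀ y₁ y₂, E u y₁ → E u y₂ → y₁ ≠ y₂ → heavy y₁ →
      H.EdgesOnCycle 6 s(u, y₁) s(u, y₂) := by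
    intro y₁ y₂ h₁ h₂ hy hh
    obtain ⟨w, hw, hwu⟩ := h.exists_ne h₂
    obtain ⟨x, u', hx, hx', hu', hxF, huF⟩ := h.path hw h₁ hh {u, y₁, y₂, w}
      (Finset.card_le_four.trans (by simp))
    exact h.six hE h₂ hw hx hx' hu' h₁ (by grind) (by grind) (by simp) (by simp)
  by_cases hh₁ : heavy y₁
  · exact key _ _ h₁ h₂ hy hh₁
  by_cases hh₂ : heavy y₂
  · exact (key _ _ h₂ h₁ hy.symm hh₂).symm
  have hz₁ := h.hub_left h₁ hh₁
  have hz₂ := h.hub_left h₂ hh₂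
  have hv := h.heavy_hub
  by_cases huz : u = z
  · subst huz
    obtain ⟨w₁, hw₁, hwu₁⟩ := h.exists_ne h₁
    obtain ⟨w₂, hw₂, hwu₂⟩ := h.exists_ne h₂
    by_cases hw : w₁ = w₂
    · subst hw
      exact h.four hE h₁ hw₁ hw₂ h₂ hwu₁.symm hy (by simp) (by simp)
    · exact h.six hE h₁ hw₁ (h.hub_right hw₁) (h.hub_right hw₂) hw₂ h₂ (by grind) (by grind)
        (by simp) (by simp)
  · exact h.four hE h₁ hz₁ hz₂ h₂ huz hy (by simp) (by simp)

open Classical in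
theorem disjoint_hub (h : HubSystem E heavy v z) (hE : ∀ u y, E u y → H.Adj u y)
    {u₁ u₂ y : V} (h₁ : E u₁ v) (h₂ : E u₂ y) (hu : u₁ ≠ u₂) (hy : y ≠ v) :
    H.EdgesOnCycle 6 s(u₁, v) s(u₂, y) := by
  by_cases hh : heavy y
  · obtain ⟨x, u', hx, hx', hu', hxF, huF⟩ := h.path h₁ h₂ hh {u₁, u₂, v, y}
      (Finset.card_le_four.trans (by simp))
    exact h.six hE h₁ (h.hub_right h₂) h₂ hu' hx' hx (by grind) (by grind) (by simp) (by simp)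
  have hz := h.hub_left h₂ hh
  by_cases hz₁ : u₁ = z
  · subst hz₁
    exact h.four hE h₁ (h.hub_right h₂) h₂ hz hu hy.symm (by simp) (by simp)
  obtain ⟨x, hx, hzx, hxF⟩ := h.common h₁ hz₁ {v, y} (Finset.card_le_two.trans (by simp))
  by_cases hz₂ : u₂ = z
  · subst hz₂
    obtain ⟨w, hw, hwu⟩ := h.exists_ne h₂
    by_cases hw₁ : w = u₁
    · subst hw₁
      exact h.four hE h₁ (h.hub_right h₂) h₂ hw hu hy.symm (by simp) (by simp)
    · exact h.six hE h₁ (h.hub_right hw) hw h₂ hzx hx (by grind) (by grind) (by simp) (by simp)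
  · exact h.six hE h₁ (h.hub_right h₂) h₂ hz hzx hx (by grind) (by grind) (by simp) (by simp)

open Classical in
theorem disjoint_heavy (h : HubSystem E heavy v z) (hE : ∀ u y, E u y → H.Adj u y)
    {u₁ u₂ y₁ y₂ : V} (h₁ : E u₁ y₁) (h₂ : E u₂ y₂) (hu : u₁ ≠ u₂) (hy : y₁ ≠ y₂)
    (hv₁ : y₁ ≠ v) (hv₂ : y₂ ≠ v) (hh : heavy y₁) :
    H.EdgesOnCycle 8 s(u₁, y₁) s(u₂, y₂) := by
  obtain ⟨w, hw, hwu⟩ := h.exists_ne h₂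
  obtain ⟨x, u', hx, hx', hu', hxF, huF⟩ := h.path h₂ h₁ hh {u₁, u₂, w, v, y₁, y₂}
    Finset.card_le_six
  by_cases hw₁ : w = u₁
  · subst hw₁
    exact (h.six hE hw h₂ hx hx' hu' h₁ (by grind) (by grind) (by simp) (by simp)).mono
      (by norm_num)
  · exact h.eight hE h₁ hu' hx' hx h₂ hw (h.hub_right hw) (h.hub_right h₁)
      (by grind) (by grind) (by simp) (by simp)

open Classical in
theorem disjoint (h : HubSystem E heavy v z) (hE : ∀ u y, E u y → H.Adj u y)
    {u₁ u₂ y₁ y₂ : V} (h₁ : E u₁ y₁) (h₂ : E u₂ y₂) (hu : u₁ ≠ u₂) (hy : y₁ ≠ y₂) :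
    H.EdgesOnCycle 8 s(u₁, y₁) s(u₂, y₂) := by
  by_cases hv₁ : y₁ = v
  · subst hv₁
    exact (h.disjoint_hub hE h₁ h₂ hu hy.symm).mono (by norm_num)
  by_cases hv₂ : y₂ = v
  · subst hv₂
    exact (h.disjoint_hub hE h₂ h₁ hu.symm hy).symm.mono (by norm_num)
  by_cases hh₁ : heavy y₁
  · exact h.disjoint_heavy hE h₁ h₂ hu hy hv₁ hv₂ hh₁
  by_cases hh₂ : heavy y₂
  · exact (h.disjoint_heavy hE h₂ h₁ hu.symm hy.symm hv₂ hv₁ hh₂).symm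
  have key : ∀ u₂ y₁ y₂, E z y₁ → E u₂ y₂ → E z y₂ → z ≠ u₂ → y₁ ≠ y₂ → y₁ ≠ v → y₂ ≠ v →
      H.EdgesOnCycle 6 s(z, y₁) s(u₂, y₂) := by
    intro u₂ y₁ y₂ h₁ h₂ hz₂ hu hy hv₁ hv₂
    obtain ⟨w, hw, hwu⟩ := h.exists_ne h₁
    by_cases hw₁ : w = u₂
    · subst hw₁
      exact h.four hE h₁ hw h₂ hz₂ hu hy (by simp) (by simp)
    · exact h.six hE h₁ hw (h.hub_right hw) (h.hub_right h₂) h₂ hz₂ (by grind) (by grind)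
        (by simp) (by simp)
  have hz₁ := h.hub_left h₁ hh₁
  have hz₂ := h.hub_left h₂ hh₂
  refine EdgesOnCycle.mono (k := 6) (by norm_num) ?_
  by_cases hu₁ : u₁ = z
  · subst hu₁
    exact key _ _ _ h₁ h₂ hz₂ hu hy hv₁ hv₂
  by_cases hu₂ : u₂ = z
  · subst hu₂
    exact (key _ _ _ h₂ h₁ hz₁ hu.symm hy.symm hv₂ hv₁).symm
  exact h.six hE h₁ hz₁ hz₂ h₂ (h.hub_right h₂) (h.hub_right h₁) (by grind) (by grind)
    (by simp) (by simp)

theorem exists_eq (hE : ∀ u y, H.Adj u y ↔ E u y ∨ E y u)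
    {e : Sym2 V} (he : e ∈ H.edgeSet) : ∃ u y, e = s(u, y) ∧ E u y := by
  induction e with
  | h p q =>
    rcases (hE p q).1 he with hpq | hpq
    · exact ⟨p, q, rfl, hpq⟩
    · exact ⟨q, p, Sym2.eq_swap, hpq⟩

theorem edgesOnCycle_six (h : HubSystem E heavy v z) (hE : ∀ u y, H.Adj u y ↔ E u y ∨ E y u)
    {e₁ e₂ : Sym2 V} (he₁ : e₁ ∈ H.edgeSet) (he₂ : e₂ ∈ H.edgeSet) (hne : e₁ ≠ e₂)
    (hx : ∃ x, x ∈ e₁ ∧ x ∈ e₂) : H.EdgesOnCycle 6 e₁ e₂ := by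
  have hE' : ∀ u y, E u y → H.Adj u y := fun u y huy => (hE u y).2 (.inl huy)
  obtain ⟨u₁, y₁, rfl, h₁⟩ := exists_eq hE he₁
  obtain ⟨u₂, y₂, rfl, h₂⟩ := exists_eq hE he₂
  have hn₁ := h.ne h₁ h₂
  have hn₂ := h.ne h₂ h₁
  by_cases hu : u₁ = u₂
  · subst hu
    exact h.common_left hE' h₁ h₂ (by grind)
  by_cases hy : y₁ = y₂
  · subst hy
    exact h.common_right hE' h₁ h₂ hu
  grind

theorem edgesOnCycle_eight (h : HubSystem E heavy v z) (hE : ∀ u y, H.Adj u y ↔ E u y ∨ E y u)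
    {e₁ e₂ : Sym2 V} (he₁ : e₁ ∈ H.edgeSet) (he₂ : e₂ ∈ H.edgeSet) :
    H.EdgesOnCycle 8 e₁ e₂ := by
  have hE' : ∀ u y, E u y → H.Adj u y := fun u y huy => (hE u y).2 (.inl huy)
  obtain ⟨u₁, y₁, rfl, h₁⟩ := exists_eq hE he₁
  obtain ⟨u₂, y₂, rfl, h₂⟩ := exists_eq hE he₂
  by_cases hu : u₁ = u₂
  · subst hu
    refine EdgesOnCycle.mono (k := 6) (by norm_num) ?_
    by_cases hy : y₁ = y₂
    · subst hy
      obtain ⟨w, hw, hwu⟩ := h.exists_ne h₁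
      obtain ⟨b, c, hc, hl, hm, -⟩ := h.common_right hE' h₁ hw hwu.symm
      exact ⟨b, c, hc, hl, hm, hm⟩
    · exact h.common_left hE' h₁ h₂ hy
  by_cases hy : y₁ = y₂
  · subst hy
    exact (h.common_right hE' h₁ h₂ hu).mono (by norm_num)
  exact h.disjoint hE' h₁ h₂ hu hy

end HubSystem
open Finset Classical

/-- A graph with more than `c * |V|` edges has a nonempty induced subgraph of minimum degree at
least `c`. -/
theorem exists_finset_le_card_filter_adj [Fintype V] (G : SimpleGraph V) {c : ℝ}
    (h : c * Fintype.card V < G.edgeSet.ncard) :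
    ∃ W : Finset V, W.Nonempty ∧ ∀ w ∈ W, c ≤ #{x ∈ W | G.Adj w x} := by
  let f : V → V → ℝ := fun a b => if G.Adj a b then 1 else 0
  have hf : ∀ a b, f a b = f b a := fun a b => by simp [f, G.adj_comm]
  have hff : ∀ a, f a a = 0 := fun a => by simp [f]
  have hcard : ∀ (T : Finset V) a, (#{x ∈ T | G.Adj a x} : ℝ) = ∑ b ∈ T, f a b := by
    intro T a
    simp [f]
  let φ : Finset V → ℝ := fun W => ∑ a ∈ W, ∑ b ∈ W, f a b - 2 * c * #W
  obtain ⟨W, -, hW⟩ := exists_max_image (univ : Finset (Finset V)) φ ⟨∅, mem_univ _⟩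
  refine ⟨W, ?_, ?_⟩
  · rw [nonempty_iff_ne_empty]
    rintro rfl
    have h1 := hW univ (mem_univ _)
    have h2 : ∑ a : V, ∑ b : V, f a b = 2 * G.edgeSet.ncard := by
      have h3 := G.sum_degrees_eq_twice_card_edges
      rw [← coe_edgeFinset, Set.ncard_coe_finset]
      have h4 : ∀ a, ∑ b : V, f a b = G.degree a := by
        intro a
        rw [← hcard, ← card_neighborFinset_eq_degree, neighborFinset_eq_filter]
      simp_rw [h4]
      exact_mod_cast h3
    simp only [φ, h2, sum_empty, card_empty, card_univ] at h1
    push_cast at h1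
    linarith
  · intro w hw
    have h1 := hW (W.erase w) (mem_univ _)
    obtain ⟨S, hS, rfl⟩ : ∃ S, w ∉ S ∧ insert w S = W := ⟨W.erase w, by simp, by simp [hw]⟩
    rw [erase_insert hS] at h1
    have h2 : ∑ a ∈ S, f a w = ∑ a ∈ S, f w a := sum_congr rfl fun a _ => hf a w
    simp only [φ, sum_insert hS, card_insert_of_notMem hS, sum_add_distrib, hff, h2] at h1
    rw [hcard, sum_insert hS, hff]
    push_cast at h1
    linarith

/-- A maximum cut of the vertex set `W` keeps at least half of the degree of every vertex. -/
theorem exists_cut (G : SimpleGraph V) (W : Finset V) :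
    ∃ A B : Finset V, Disjoint A B ∧ A ∪ B = W ∧
      (∀ a ∈ A, #{x ∈ W | G.Adj a x} ≤ 2 * #{x ∈ B | G.Adj a x}) ∧
      ∀ b ∈ B, #{x ∈ W | G.Adj b x} ≤ 2 * #{x ∈ A | G.Adj b x} := by
  let f : V → V → ℕ := fun a b => if G.Adj a b then 1 else 0
  have hf : ∀ a b, f a b = f b a := fun a b => by simp [f, G.adj_comm]
  have hcard : ∀ (T : Finset V) a, #{x ∈ T | G.Adj a x} = ∑ b ∈ T, f a b := by
    intro T a
    simp [f]
  have hff : ∀ a, f a a = 0 := fun a => by simp [f]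
  obtain ⟨S, hS, hmax⟩ := exists_max_image W.powerset
    (fun S => ∑ a ∈ S, ∑ b ∈ W \ S, f a b) ⟨∅, by simp⟩
  rw [mem_powerset] at hS
  have hsplit : ∀ a, ∑ x ∈ W, f a x = ∑ x ∈ S, f a x + ∑ x ∈ W \ S, f a x := by
    intro a
    rw [add_comm, sum_sdiff hS]
  refine ⟨S, W \ S, disjoint_sdiff, union_sdiff_of_subset hS, ?_, ?_⟩
  · intro a ha
    have h1 := hmax (S.erase a) (by simpa using (erase_subset a S).trans hS)
    rw [hcard, hcard, hsplit]
    obtain ⟨S₀, hS₀, rfl⟩ : ∃ S₀, a ∉ S₀ ∧ insert a S₀ = S := ⟨S.erase a, by simp, by simp [ha]⟩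
    have hT : W \ S₀ = insert a (W \ insert a S₀) := by
      ext x
      have := hS ha
      simp only [mem_sdiff, mem_insert]
      grind
    have hT' : a ∉ W \ insert a S₀ := by simp
    have h2 : ∑ x ∈ S₀, f x a = ∑ x ∈ S₀, f a x := sum_congr rfl fun x _ => hf x a
    rw [erase_insert hS₀, hT] at h1
    simp only [sum_insert hS₀, sum_insert hT', sum_add_distrib, h2, hff] at h1 ⊢
    lia
  · intro b hb
    rw [mem_sdiff] at hb
    have h1 := hmax (insert b S) (by simpa [insert_subset_iff] using ⟨hb.1, hS⟩)
    rw [hcard, hcard, hsplit]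
    have hT : W \ S = insert b (W \ insert b S) := by
      ext x
      simp only [mem_sdiff, mem_insert]
      grind
    have hT' : b ∉ W \ insert b S := by simp
    have h2 : ∑ x ∈ S, f x b = ∑ x ∈ S, f b x := sum_congr rfl fun x _ => hf x b
    rw [hT] at h1 ⊢
    simp only [sum_insert hb.2, sum_insert hT', sum_add_distrib, h2, hff] at h1 ⊢
    lia

/-- An edge `vz` such that few pairs of neighbours of `v` have fewer than seven
common neighbours adjacent to `z`. -/
theorem exists_edge_few_bad_pairs (G : SimpleGraph V) {A B : Finset V} {d : ℝ} (hd : 0 < d)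
    (hA : A.Nonempty) (hdeg : ∀ a ∈ A, d ≤ #{b ∈ B | G.Adj a b})
    (hB : 112 * (#B : ℝ) ^ 3 < d ^ 4) :
    ∃ v ∈ A, ∃ z ∈ B, G.Adj v z ∧
      16 * #A * ((∑ u ∈ B with G.Adj v u, #{w ∈ B | G.Adj v w ∧
        #{x ∈ A | G.Adj x u ∧ G.Adj x w ∧ G.Adj x z} < 7} : ℕ) : ℝ) <
        (#{b ∈ B | G.Adj v b} : ℝ) ^ 2 * d := by
  by_contra! hcon
  have hcount : ∑ a ∈ A, ∑ z ∈ B with G.Adj a z, ∑ u ∈ B with G.Adj a u, #{w ∈ B | G.Adj a w ∧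
        #{x ∈ A | G.Adj x u ∧ G.Adj x w ∧ G.Adj x z} < 7} ≤ 7 * #B ^ 3 := by
    simp only [sum_filter]
    calc _ ≤ ∑ a ∈ A, ∑ z ∈ B, ∑ u ∈ B, ∑ w ∈ B,
          (if (G.Adj a u ∧ G.Adj a w ∧ G.Adj a z) ∧
            #{x ∈ A | G.Adj x u ∧ G.Adj x w ∧ G.Adj x z} < 7 then 1 else 0) := by
          refine sum_le_sum fun a _ => sum_le_sum fun z _ => ?_
          split_ifs with h1
          · refine sum_le_sum fun u _ => ?_
            split_ifs with h2
            · rw [card_filter]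
              exact sum_le_sum fun w _ => by simp [h1, h2]
            · exact Nat.zero_le _
          · exact Nat.zero_le _
      _ = ∑ z ∈ B, ∑ u ∈ B, ∑ w ∈ B, ∑ a ∈ A,
          (if (G.Adj a u ∧ G.Adj a w ∧ G.Adj a z) ∧
            #{x ∈ A | G.Adj x u ∧ G.Adj x w ∧ G.Adj x z} < 7 then 1 else 0) := by
          rw [sum_comm]
          refine sum_congr rfl fun z _ => ?_
          rw [sum_comm]
          exact sum_congr rfl fun u _ => sum_comm
      _ ≤ ∑ z ∈ B, ∑ u ∈ B, ∑ w ∈ B, 7 := by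
          refine sum_le_sum fun z _ => sum_le_sum fun u _ => sum_le_sum fun w _ => ?_
          by_cases h7 : #{x ∈ A | G.Adj x u ∧ G.Adj x w ∧ G.Adj x z} < 7
          · simp only [h7, and_true, ← card_filter]
            exact h7.le
          · simp [h7]
      _ = 7 * #B ^ 3 := by
          simp only [sum_const, smul_eq_mul]
          ring
  have hApos : (0 : ℝ) < #A := by exact_mod_cast hA.card_pos
  have hlow : #A * d ^ 4 ≤ 16 * #A * ((∑ a ∈ A, ∑ z ∈ B with G.Adj a z,
      ∑ u ∈ B with G.Adj a u, #{w ∈ B | G.Adj a w ∧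
        #{x ∈ A | G.Adj x u ∧ G.Adj x w ∧ G.Adj x z} < 7} : ℕ) : ℝ) := by
    rw [Nat.cast_sum, mul_sum, ← nsmul_eq_mul]
    refine card_nsmul_le_sum _ _ _ fun a ha => ?_
    rw [Nat.cast_sum, mul_sum]
    have hm := hdeg a ha
    set m : ℝ := (#{b ∈ B | G.Adj a b} : ℝ) with hmdef
    have h1 : m * (m ^ 2 * d) ≤ ∑ z ∈ B with G.Adj a z, 16 * #A *
        ((∑ u ∈ B with G.Adj a u, #{w ∈ B | G.Adj a w ∧
        #{x ∈ A | G.Adj x u ∧ G.Adj x w ∧ G.Adj x z} < 7} : ℕ) : ℝ) := by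
      rw [hmdef, ← nsmul_eq_mul, ← hmdef]
      refine card_nsmul_le_sum _ _ _ fun z hz => ?_
      rw [mem_filter] at hz
      exact hcon a ha z hz.1 hz.2
    refine le_trans ?_ h1
    calc d ^ 4 = d ^ 3 * d := by ring
      _ ≤ m ^ 3 * d := by gcongr
      _ = m * (m ^ 2 * d) := by ring
  have hcount' : ((∑ a ∈ A, ∑ z ∈ B with G.Adj a z,
      ∑ u ∈ B with G.Adj a u, #{w ∈ B | G.Adj a w ∧
        #{x ∈ A | G.Adj x u ∧ G.Adj x w ∧ G.Adj x z} < 7} : ℕ) : ℝ) ≤ 7 * (#B : ℝ) ^ 3 := by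
    exact_mod_cast hcount
  have : #A * d ^ 4 ≤ #A * (112 * (#B : ℝ) ^ 3) := by
    refine hlow.trans ?_
    calc _ ≤ 16 * (#A : ℝ) * (7 * (#B : ℝ) ^ 3) := by gcongr
      _ = _ := by ring
  exact absurd (le_of_mul_le_mul_left this hApos) (not_le.2 hB)

/-- The terms of a sum that are at least half of the average contribute at least half of it. -/
theorem half_le_sum_filter {A : Finset V} (hA : A.Nonempty) {f : V → ℝ} {S : ℝ}
    (hS0 : 0 ≤ S) (hS : S ≤ ∑ a ∈ A, f a) : S / 2 ≤ ∑ a ∈ A with S ≤ 2 * #A * f a, f a := by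
  have hApos : (0 : ℝ) < #A := by exact_mod_cast hA.card_pos
  have h1 := sum_filter_add_sum_filter_not A (fun a => S ≤ 2 * #A * f a) f
  have h2 : ∑ a ∈ A with ¬ S ≤ 2 * #A * f a, f a ≤ S / 2 := by
    refine (sum_le_card_nsmul _ _ (S / (2 * #A)) fun a ha => ?_).trans ?_
    · rw [le_div_iff₀ (by positivity)]
      linarith [(mem_filter.1 ha).2]
    · rw [nsmul_eq_mul]
      calc _ ≤ #A * (S / (2 * #A)) := by
            gcongr
            exact filter_subset _ _
        _ = S / 2 := by field_simp
  linarith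

theorem sum_card_filter_adj_comm (G : SimpleGraph V) (U A : Finset V) :
    ∑ u ∈ U, #{a ∈ A | G.Adj u a} = ∑ a ∈ A, #{u ∈ U | G.Adj a u} := by
  simp only [card_filter]
  rw [sum_comm]
  exact sum_congr rfl fun a _ => sum_congr rfl fun u _ => by rw [G.adj_comm u a]

set_option maxHeartbeats 400000 in
/-- A bipartite graph of minimum degree at least `d` with parts small compared to `d` contains a
hub system with at least `d ^ 2 / 4` edges. -/
theorem exists_hubSystem (G : SimpleGraph V) {A B : Finset V} {d : ℝ} (hd : 0 < d)
    (hAB : Disjoint A B) (hA : A.Nonempty) (hdegA : ∀ a ∈ A, d ≤ #{b ∈ B | G.Adj a b})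
    (hdegB : ∀ b ∈ B, d ≤ #{a ∈ A | G.Adj b a})
    (hB : 112 * (#B : ℝ) ^ 3 < d ^ 4) (hAd : 64 * (#A : ℝ) ≤ d ^ 2) :
    ∃ (E : V → V → Prop) (heavy : V → Prop) (v z : V), HubSystem E heavy v z ∧
      (∀ u y, E u y → G.Adj u y) ∧
      d ^ 2 / 4 ≤ #{p ∈ B ×ˢ A | E p.1 p.2} := by
  obtain ⟨v, hv, z, hz, hvz, hbad⟩ := exists_edge_few_bad_pairs G hd hA hdegA hB
  have hApos : (0 : ℝ) < #A := by exact_mod_cast hA.card_pos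
  have hm := hdegA v hv
  set bad : V → Finset V := fun u => {w ∈ B | G.Adj v w ∧
        #{x ∈ A | G.Adj x u ∧ G.Adj x w ∧ G.Adj x z} < 7} with hbaddef
  set N : Finset V := {b ∈ B | G.Adj v b} with hN
  set m : ℝ := (#N : ℝ) with hmdef
  have hmpos : 0 < m := hd.trans_le hm
  let U : Finset V := {u ∈ N | 8 * #A * (#(bad u) : ℝ) ≤ m * d}
  have hUN : U ⊆ N := filter_subset _ _
  have hUB : U ⊆ B := hUN.trans (filter_subset _ _)
  have hUm : m / 2 < #U := by
    have h1 : (#(N \ U) : ℝ) * (2 * (m * d)) ≤ 16 * #A * ((∑ u ∈ N, #(bad u) : ℕ) : ℝ) := by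
      rw [Nat.cast_sum, mul_sum, ← nsmul_eq_mul]
      refine (card_nsmul_le_sum _ _ _ fun u hu => ?_).trans
        (sum_le_sum_of_subset_of_nonneg (sdiff_subset (s := N) (t := U))
          fun _ _ _ => by positivity)
      simp only [U, mem_sdiff, mem_filter, not_and, not_le] at hu
      linarith [hu.2 hu.1]
    have h2 : (#(N \ U) : ℝ) + #U = m := by
      rw [hmdef]
      exact_mod_cast card_sdiff_add_card_eq_card hUN
    have h3 : (#(N \ U) : ℝ) * 2 * (m * d) < m * (m * d) := by nlinarith
    have h4 := lt_of_mul_lt_mul_right h3 (by positivity)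
    linarith
  have hUpos : (0 : ℝ) < #U := by linarith
  have hmd : 8 * #A ≤ m * d / 8 := by nlinarith
  have hNbad : ∀ u ∈ U, ∃ w ∈ N, w ∉ bad u := by
    intro u hu
    have h1 := (mem_filter.1 hu).2
    have h2 : #(bad u) < #N := by
      have : d ≤ #A := by
        refine (hdegB u (hUB hu)).trans ?_
        exact_mod_cast card_filter_le _ _
      have h3 : (#(bad u) : ℝ) < m := by
        by_contra! hcon
        nlinarith
      rw [hmdef] at h3
      exact_mod_cast h3
    obtain ⟨w, hw, hw'⟩ := exists_mem_notMem_of_card_lt_card h2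
    exact ⟨w, hw, hw'⟩
  have hcommon : ∀ u ∈ U, 7 ≤ #{x ∈ A | G.Adj x u ∧ G.Adj x z} := by
    intro u hu
    obtain ⟨w, hw, hw'⟩ := hNbad u hu
    simp only [hN, mem_filter] at hw
    simp only [hbaddef, mem_filter, hw, true_and, not_lt] at hw'
    refine hw'.trans (card_le_card fun x hx => ?_)
    simp only [mem_filter] at hx ⊢
    tauto
  have hzU : z ∈ U := by
    obtain ⟨u, hu⟩ : U.Nonempty := card_pos.1 (by exact_mod_cast hUpos)
    refine mem_filter.2 ⟨by simp [hN, hz, hvz], le_trans ?_ (mem_filter.1 hu).2⟩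
    gcongr
    intro w hw
    simp only [hbaddef, mem_filter] at hw ⊢
    refine ⟨hw.1, hw.2.1, lt_of_le_of_lt (card_le_card fun x hx => ?_) hw.2.2⟩
    simp only [mem_filter] at hx ⊢
    tauto
  let heavy : V → Prop := fun a => #U * d ≤ 2 * #A * (#{u ∈ U | G.Adj a u} : ℝ)
  let E : V → V → Prop := fun u y => u ∈ U ∧ y ∈ A ∧ G.Adj u y ∧
    (heavy y ∨ G.Adj z y ∧ ∃ w ∈ U, w ≠ z ∧ G.Adj w y)
  have hheavy : ∀ a, heavy a → ∀ u ∈ U, ∀ F : Finset V, #F ≤ 6 →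
      ∃ w ∈ U, G.Adj a w ∧ w ∉ bad u ∧ w ≠ u ∧ w ∉ F := by
    intro a ha u hu F hF
    have h1 := (mem_filter.1 hu).2
    have h2 : #(bad u ∪ insert u F) < #{w ∈ U | G.Adj a w} := by
      have h3 : (#(bad u ∪ insert u F) : ℝ) ≤ #(bad u) + 7 := by
        exact_mod_cast (card_union_le _ _).trans
          (Nat.add_le_add_left ((card_insert_le _ _).trans (by lia)) _)
      have h4 : (#(bad u) : ℝ) + 7 < #{w ∈ U | G.Adj a w} := by
        have ha' : #U * d ≤ 2 * #A * (#{w ∈ U | G.Adj a w} : ℝ) := ha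
        by_contra! hcon
        have h5 : m / 2 * d ≤ #U * d := by gcongr
        have h6 : 2 * (#A : ℝ) * #{w ∈ U | G.Adj a w} ≤ 2 * #A * (#(bad u) + 7) := by gcongr
        nlinarith
      exact_mod_cast h3.trans_lt h4
    obtain ⟨w, hw, hw'⟩ := exists_mem_notMem_of_card_lt_card h2
    simp only [mem_filter] at hw
    simp only [mem_union, mem_insert, not_or] at hw'
    exact ⟨w, hw.1, hw.2, hw'.1, hw'.2.1, hw'.2.2⟩
  have hlight : ∀ u ∈ U, ∀ w ∈ U, w ≠ u → ∀ x ∈ A, G.Adj x u → G.Adj x w → G.Adj x z →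
      E u x ∧ E w x ∧ E z x := by
    intro u hu w hw hwu x hx hxu hxw hxz
    have key : ∃ w ∈ U, w ≠ z ∧ G.Adj w x := by
      by_cases huz : u = z
      · exact ⟨w, hw, huz ▸ hwu, hxw.symm⟩
      · exact ⟨u, hu, huz, hxu.symm⟩
    exact ⟨⟨hu, hx, hxu.symm, .inr ⟨hxz.symm, key⟩⟩, ⟨hw, hx, hxw.symm, .inr ⟨hxz.symm, key⟩⟩,
      ⟨hzU, hx, hxz.symm, .inr ⟨hxz.symm, key⟩⟩⟩
  have hvheavy : heavy v := by
    have h1 : {u ∈ U | G.Adj v u} = U :=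
      filter_true_of_mem fun u hu => (mem_filter.1 (hUN hu)).2
    have h2 : d ≤ #A := by
      refine (hdegB z hz).trans ?_
      exact_mod_cast card_filter_le _ _
    change #U * d ≤ 2 * #A * (#{u ∈ U | G.Adj v u} : ℝ)
    rw [h1]
    nlinarith
  refine ⟨E, heavy, v, z, ?_, fun u y h => h.2.2.1, ?_⟩
  · constructor
    · rintro u y u' y' ⟨hu, -⟩ ⟨-, hy, -⟩ rfl
      exact Finset.disjoint_left.1 hAB hy (hUB hu)
    · rintro u y ⟨hu, -⟩
      exact ⟨hu, hv, (mem_filter.1 (hUN hu)).2.symm, .inl hvheavy⟩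
    · rintro u y ⟨hu, hy, huy, h⟩ hh
      exact ⟨hzU, hy, (h.resolve_left hh).1, h⟩
    · exact hvheavy
    · exact ⟨hzU, hv, hvz.symm, .inl hvheavy⟩
    · rintro u y ⟨hu, hy, huy, h⟩
      rcases h with h | ⟨hzy, w, hw, hwz, hwy⟩
      · obtain ⟨w, hw, hyw, -, hwu, -⟩ := hheavy y h u hu ∅ (by simp)
        exact ⟨w, ⟨hw, hy, hyw.symm, .inl h⟩, hwu⟩
      · by_cases huz : u = z
        · exact ⟨w, ⟨hw, hy, hwy, .inr ⟨hzy, w, hw, hwz, hwy⟩⟩, huz ▸ hwz⟩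
        · exact ⟨z, ⟨hzU, hy, hzy, .inr ⟨hzy, w, hw, hwz, hwy⟩⟩, Ne.symm huz⟩
    · rintro u y w a ⟨hu, -⟩ ⟨-, ha, -⟩ hh F hF
      obtain ⟨u', hu', hau', hgood, hne, hF'⟩ := hheavy a hh u hu F hF
      have hu'N := mem_filter.1 (hUN hu')
      simp only [hbaddef, mem_filter, hu'N, true_and, not_lt] at hgood
      obtain ⟨x, hx, hxF⟩ := exists_mem_notMem_of_card_lt_card
        (lt_of_lt_of_le (by lia : #F < 7) hgood)
      simp only [mem_filter] at hx
      have h := hlight u hu u' hu' hne x hx.1 hx.2.1 hx.2.2.1 hx.2.2.2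
      exact ⟨x, u', h.1, h.2.1, ⟨hu', ha, hau'.symm, .inl hh⟩, hxF, hF'⟩
    · rintro u y ⟨hu, -⟩ huz F hF
      obtain ⟨x, hx, hxF⟩ := exists_mem_notMem_of_card_lt_card
        (lt_of_lt_of_le (by lia : #F < 7) (hcommon u hu))
      simp only [mem_filter] at hx
      have h := hlight u hu z hzU (Ne.symm huz) x hx.1 hx.2.1 hx.2.2 hx.2.2
      exact ⟨x, h.1, h.2.1, hxF⟩
  · have h1 : #U * d ≤ ∑ u ∈ U, (#{a ∈ A | G.Adj u a} : ℝ) := by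
      rw [← nsmul_eq_mul]
      exact card_nsmul_le_sum _ _ _ fun u hu => hdegB u (hUB hu)
    have h2 : ∑ u ∈ U, (#{a ∈ A | G.Adj u a} : ℝ) = ∑ a ∈ A, (#{u ∈ U | G.Adj a u} : ℝ) := by
      exact_mod_cast sum_card_filter_adj_comm G U A
    have h4 : #U * d / 2 ≤ ∑ a ∈ A with heavy a, (#{u ∈ U | G.Adj a u} : ℝ) :=
      half_le_sum_filter hA (by positivity) (h1.trans h2.le)
    have h5 : ∑ a ∈ A with heavy a, (#{u ∈ U | G.Adj a u} : ℝ) ≤ #{p ∈ B ×ˢ A | E p.1 p.2} := by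
      have h6 : ∑ a ∈ A with heavy a, #{u ∈ U | G.Adj a u} ≤ #{p ∈ B ×ˢ A | E p.1 p.2} := by
        rw [← card_sigma]
        refine card_le_card_of_injOn (fun p => (p.2, p.1)) ?_ ?_
        · rintro ⟨a, u⟩ h
          simp only [coe_sigma, Set.mem_sigma_iff, mem_coe, mem_filter] at h
          simp only [mem_coe, mem_filter, mem_product]
          exact ⟨⟨hUB h.2.1, h.1.1⟩, h.2.1, h.1.1, h.2.2.symm, .inl h.1.2⟩
        · rintro ⟨a, u⟩ - ⟨a', u'⟩ - h
          simp only [Prod.mk.injEq] at h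
          obtain ⟨rfl, rfl⟩ := h
          rfl
      exact_mod_cast h6
    have h6 : d / 2 * d ≤ #U * d := by
      gcongr
      linarith
    refine le_trans ?_ (h5.trans_eq ?_)
    · linarith
    · congr!

/-- A graph with more than `2 * d * |V|` edges, `d` large compared to `|V|`, contains a
subgraph with at least `d ^ 2 / 4` edges in which any two edges lie on a cycle of length at most 8,
and any two adjacent edges on a cycle of length at most 6. -/
theorem exists_le_edgesOnCycle [Fintype V] (G : SimpleGraph V) {d : ℝ} (hd : 0 < d)
    (hG : 2 * d * Fintype.card V < G.edgeSet.ncard)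
    (h3 : 112 * (Fintype.card V : ℝ) ^ 3 < d ^ 4) (h1 : 64 * (Fintype.card V : ℝ) ≤ d ^ 2) :
    ∃ H ≤ G, d ^ 2 / 4 ≤ H.edgeSet.ncard ∧
      (∀ e₁ ∈ H.edgeSet, ∀ e₂ ∈ H.edgeSet, H.EdgesOnCycle 8 e₁ e₂) ∧
      ∀ e₁ ∈ H.edgeSet, ∀ e₂ ∈ H.edgeSet, e₁ ≠ e₂ → (∃ x, x ∈ e₁ ∧ x ∈ e₂) →
        H.EdgesOnCycle 6 e₁ e₂ := by
  obtain ⟨W, ⟨w, hw⟩, hW⟩ := exists_finset_le_card_filter_adj G (c := 2 * d) hG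
  obtain ⟨A, B, hAB, rfl, hA, hB⟩ := exists_cut G W
  have hdegA : ∀ a ∈ A, d ≤ #{b ∈ B | G.Adj a b} := fun a ha => by
    have h := hW a (mem_union_left _ ha)
    have h' : (#{x ∈ A ∪ B | G.Adj a x} : ℝ) ≤ 2 * #{x ∈ B | G.Adj a x} := by
      exact_mod_cast hA a ha
    linarith
  have hdegB : ∀ b ∈ B, d ≤ #{a ∈ A | G.Adj b a} := fun b hb => by
    have h := hW b (mem_union_right _ hb)
    have h' : (#{x ∈ A ∪ B | G.Adj b x} : ℝ) ≤ 2 * #{x ∈ A | G.Adj b x} := by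
      exact_mod_cast hB b hb
    linarith
  have hAne : A.Nonempty := by
    rcases mem_union.1 hw with hw | hw
    · exact ⟨w, hw⟩
    · have h : 0 < #{a ∈ A | G.Adj w a} := by exact_mod_cast hd.trans_le (hdegB w hw)
      exact (card_pos.1 h).mono (filter_subset _ _)
  have hAn : (#A : ℝ) ≤ Fintype.card V := by exact_mod_cast card_le_univ A
  have hBn : (#B : ℝ) ≤ Fintype.card V := by exact_mod_cast card_le_univ B
  obtain ⟨E, heavy, v, z, hS, hEG, hE⟩ := exists_hubSystem G hd hAB hAne hdegA hdegB
    (lt_of_le_of_lt (by gcongr) h3) (by linarith)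
  let H : SimpleGraph V :=
    { Adj p q := E p q ∨ E q p
      symm := ⟨fun _ _ => Or.symm⟩
      loopless := ⟨fun p h => h.elim (fun h => (hEG p p h).ne rfl) fun h => (hEG p p h).ne rfl⟩ }
  have hH : ∀ u y, H.Adj u y ↔ E u y ∨ E y u := fun _ _ => Iff.rfl
  refine ⟨H, fun p q h => h.elim (hEG p q) fun h => (hEG q p h).symm, hE.trans ?_,
    fun _ h₁ _ h₂ => hS.edgesOnCycle_eight hH h₁ h₂,
    fun _ h₁ _ h₂ hne hx => hS.edgesOnCycle_six hH h₁ h₂ hne hx⟩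
  rw [← Set.ncard_coe_finset, Nat.cast_le]
  refine Set.ncard_le_ncard_of_injOn (fun p : V × V => s(p.1, p.2)) ?_ ?_
    (Set.toFinite H.edgeSet)
  · intro p hp
    exact .inl (mem_filter.1 hp).2
  · intro p hp q hq h
    have hp := (mem_filter.1 hp).2
    have hq := (mem_filter.1 hq).2
    rcases Sym2.eq_iff.1 h with h | h
    · exact Prod.ext h.1 h.2
    · exact absurd h.1 (hS.ne hp hq)

end SimpleGraph

open Filter in
theorem eventually_rpow_bounds {β : ℝ} (hβ0 : 0 < β) (hβ : β < 1 / 5) :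
    ∀ᶠ n : ℕ in atTop, 0 < n ∧ 112 * (n : ℝ) ^ 3 < ((n : ℝ) ^ (1 - β) / 4) ^ 4 ∧
      64 * (n : ℝ) ≤ ((n : ℝ) ^ (1 - β) / 4) ^ 2 := by
  have t : ∀ {s : ℝ}, 0 < s → Tendsto (fun n : ℕ => (n : ℝ) ^ s) atTop atTop := fun hs =>
    (tendsto_rpow_atTop hs).comp tendsto_natCast_atTop_atTop
  filter_upwards [eventually_gt_atTop 0,
    (t (s := 1 - 4 * β) (by linarith)).eventually_gt_atTop 28672,
    (t (s := 1 - 2 * β) (by linarith)).eventually_ge_atTop 1024] with n hn h4 h2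
  have hn' : (0 : ℝ) < n := by exact_mod_cast hn
  have e4 : ((n : ℝ) ^ (1 - β)) ^ 4 = n ^ 3 * (n : ℝ) ^ (1 - 4 * β) := by
    rw [← Real.rpow_natCast, ← Real.rpow_mul hn'.le, ← Real.rpow_natCast, ← Real.rpow_add hn']
    congr 1
    push_cast
    ring
  have e2 : ((n : ℝ) ^ (1 - β)) ^ 2 = n * (n : ℝ) ^ (1 - 2 * β) := by
    rw [← Real.rpow_natCast, ← Real.rpow_mul hn'.le, ← Real.rpow_one_add' hn'.le (by linarith)]
    congr 1
    push_cast
    ring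
  refine ⟨hn, ?_, ?_⟩
  · rw [div_pow, e4]
    have := mul_lt_mul_of_pos_left h4 (pow_pos hn' 3)
    linarith
  · rw [div_pow, e2]
    have := mul_le_mul_of_nonneg_left h2 hn'.le
    linarith

/-- Theorem 1 (main theorem): for every `0 < β < 1/5` and sufficiently large `n`,
every graph on `n` vertices with at least `n^(2-β)` edges contains a subgraph `G'`
with at least `(1/64) n^(2-2β)` edges such that every pair of edges of `G'` lies on
a cycle of `G'` of length at most 8, and every pair of distinct edges of `G'`
sharing a vertex lies on a cycle of `G'` of length at most 6. -/
theorem stmt_0 (β : ℝ) (hβ0 : 0 < β) (hβ : β < 1 / 5) :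
    ∃ N : ℕ, ∀ n : ℕ, N ≤ n →
      ∀ (V : Type) (_ : Fintype V) (G : SimpleGraph V),
        Fintype.card V = n →
        (n : ℝ) ^ ((2 : ℝ) - β) ≤ (G.edgeSet.ncard : ℝ) →
        ∃ G' : SimpleGraph V, G' ≤ G ∧
          (1 / 64 : ℝ) * (n : ℝ) ^ ((2 : ℝ) - 2 * β) ≤ (G'.edgeSet.ncard : ℝ) ∧
          (∀ e₁ ∈ G'.edgeSet, ∀ e₂ ∈ G'.edgeSet,
            ∃ (v : V) (c : G'.Walk v v), c.IsCycle ∧ c.length ≤ 8 ∧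
              e₁ ∈ c.edges ∧ e₂ ∈ c.edges) ∧
          (∀ e₁ ∈ G'.edgeSet, ∀ e₂ ∈ G'.edgeSet, e₁ ≠ e₂ →
            (∃ x : V, x ∈ e₁ ∧ x ∈ e₂) →
            ∃ (v : V) (c : G'.Walk v v), c.IsCycle ∧ c.length ≤ 6 ∧
              e₁ ∈ c.edges ∧ e₂ ∈ c.edges) := by
  obtain ⟨N, hN⟩ := Filter.eventually_atTop.1 (eventually_rpow_bounds hβ0 hβ)
  refine ⟨N, fun n hn V _ G hV hG => ?_⟩
  obtain ⟨hn0, h3, h1⟩ := hN n hn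
  have hn' : (0 : ℝ) < n := by exact_mod_cast hn0
  subst hV
  have hlt : 2 * ((Fintype.card V : ℝ) ^ (1 - β) / 4) * Fintype.card V < G.edgeSet.ncard := by
    have e : (Fintype.card V : ℝ) ^ (2 - β) = (Fintype.card V : ℝ) ^ (1 - β) * Fintype.card V := by
      rw [← Real.rpow_add_one hn'.ne']
      congr 1
      ring
    have hpos : (0 : ℝ) < (Fintype.card V : ℝ) ^ (2 - β) := by positivity
    linarith
  obtain ⟨H, hHG, hcard, h8, h6⟩ := G.exists_le_edgesOnCycle (by positivity) hlt h3 h1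
  refine ⟨H, hHG, le_trans (le_of_eq ?_) hcard, h8, h6⟩
  rw [div_pow, ← Real.rpow_natCast, ← Real.rpow_mul hn'.le,
    show (1 - β) * ((2 : ℕ) : ℝ) = 2 - 2 * β by push_cast; ring]
  ring
end

section
/- Let k > 0 be a real number and n a positive integer. Let H be a bipartite graph with vertex classes A and B such that |B| ≤ n and every vertex of A has degree at least n/(4k) in H. If X ⊆ A is a set such that every two distinct vertices of X have codegree in H at most n/(32k²), then |X| < 8k. -/
open Finset in
/-- If the sets `N x ⊆ B`, `x ∈ X`, have size at least `c * n / #X` on average and pairwise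
intersections of size at most `q`, where `#B ≤ n`, then `c * (c - 1) * n ≤ #X * (#X - 1) * q`. -/
theorem mul_sub_one_mul_le_of_card_inter_le {V : Type*} [DecidableEq V] (X B : Finset V)
    (N : V → Finset V) (hN : ∀ x ∈ X, N x ⊆ B) {n c q : ℝ} (hB : (#B : ℝ) ≤ n)
    (hc : 1 ≤ 2 * c) (hdeg : c * n ≤ ∑ x ∈ X, (#(N x) : ℝ))
    (hcodeg : ∀ x ∈ X, ∀ y ∈ X, x ≠ y → (#(N x ∩ N y) : ℝ) ≤ q) :
    c * (c - 1) * n ≤ #X * (#X - 1) * q := by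
  let e : V → V → ℝ := fun x b => if b ∈ N x then 1 else 0
  have hdeg_eq : ∑ b ∈ B, ∑ x ∈ X, e x b = ∑ x ∈ X, (#(N x) : ℝ) := by
    rw [sum_comm]
    refine sum_congr rfl fun x hx => ?_
    simp [e, inter_eq_right.2 (hN x hx)]
  have hcodeg_eq : ∑ b ∈ B, (∑ x ∈ X, e x b) ^ 2 = ∑ x ∈ X, ∑ y ∈ X, (#(N x ∩ N y) : ℝ) := by
    simp_rw [sq, sum_mul_sum]
    rw [sum_comm]
    refine sum_congr rfl fun x hx => ?_
    rw [sum_comm]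
    refine sum_congr rfl fun y _ => ?_
    have hsub : N x ∩ N y ⊆ B := inter_subset_left.trans (hN x hx)
    simp only [e, ← ite_and, mul_ite, mul_one, mul_zero]
    rw [← inter_eq_right.2 hsub, card_eq_sum_ones, ← filter_mem_eq_inter, sum_filter]
    push_cast
    exact sum_congr rfl fun b _ => by simp [and_comm]
  have hcodeg_le : ∑ x ∈ X, ∑ y ∈ X, (#(N x ∩ N y) : ℝ)
      ≤ ∑ x ∈ X, (#(N x) : ℝ) + #X * (#X - 1) * q := by
    calc ∑ x ∈ X, ∑ y ∈ X, (#(N x ∩ N y) : ℝ)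
        ≤ ∑ x ∈ X, ((#(N x) : ℝ) + (#X - 1) * q) := by
          refine sum_le_sum fun x hx => ?_
          rw [← add_sum_erase X _ hx, inter_self]
          gcongr
          have h := sum_le_card_nsmul (X.erase x) (fun y => (#(N x ∩ N y) : ℝ)) q
            fun y hy => hcodeg x hx y (mem_of_mem_erase hy) (ne_of_mem_erase hy).symm
          rwa [nsmul_eq_mul, cast_card_erase_of_mem hx] at h
      _ = _ := by rw [sum_add_distrib, sum_const, nsmul_eq_mul, mul_assoc]
  have hsq : 2 * c * (∑ b ∈ B, ∑ x ∈ X, e x b) - #B * c ^ 2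
      ≤ ∑ b ∈ B, (∑ x ∈ X, e x b) ^ 2 := by
    rw [mul_sum, ← nsmul_eq_mul, ← sum_const, ← sum_sub_distrib]
    exact sum_le_sum fun b _ => by nlinarith [sq_nonneg ((∑ x ∈ X, e x b) - c)]
  rw [hdeg_eq, hcodeg_eq] at hsq
  nlinarith [mul_le_mul_of_nonneg_right hB (sq_nonneg c),
    mul_le_mul_of_nonneg_left hdeg (sub_nonneg.2 hc)]

/-- Lemma 1: in a bipartite graph `H` with classes `A`, `B`, `|B| ≤ n`, in which every
vertex of `A` has degree at least `n/(4k)`, any set `X ⊆ A` all of whose pairs have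
codegree at most `n/(32k²)` satisfies `|X| < 8k`. -/
theorem stmt_1 {V : Type} [Fintype V] (k : ℝ) (hk : 0 < k) (n : ℕ) (hn : 0 < n)
    (H : SimpleGraph V) (A B : Finset V) (hdisj : Disjoint A B)
    (hbip : ∀ u v : V, H.Adj u v → (u ∈ A ∧ v ∈ B) ∨ (u ∈ B ∧ v ∈ A))
    (hB : B.card ≤ n)
    (hdeg : ∀ a ∈ A, (n : ℝ) / (4 * k) ≤ ((H.neighborSet a).ncard : ℝ))
    (X : Finset V) (hXA : X ⊆ A)
    (hcodeg : ∀ x ∈ X, ∀ y ∈ X, x ≠ y →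
      (((H.neighborSet x ∩ H.neighborSet y).ncard : ℝ)) ≤ (n : ℝ) / (32 * k ^ 2)) :
    (X.card : ℝ) < 8 * k := by
  classical
  by_contra! hX
  have hn' : (0 : ℝ) < n := by exact_mod_cast hn
  have hsub : ∀ x ∈ X, (H.neighborSet x).toFinset ⊆ B := by
    intro x hx b hb
    rw [Set.mem_toFinset] at hb
    rcases hbip x b hb with h | h
    · exact h.2
    · exact absurd h.1 (Finset.disjoint_left.1 hdisj (hXA hx))
  have hc : 2 ≤ (X.card : ℝ) / (4 * k) := by
    rw [le_div_iff₀ (by positivity)]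
    linarith
  have key := mul_sub_one_mul_le_of_card_inter_le X B (fun x => (H.neighborSet x).toFinset) hsub
    (n := n) (c := X.card / (4 * k)) (q := n / (32 * k ^ 2)) (by exact_mod_cast hB)
    (by linarith)
    (by
      have h := Finset.card_nsmul_le_sum X (fun x => (((H.neighborSet x).toFinset.card : ℕ) : ℝ))
        ((n : ℝ) / (4 * k)) fun x hx => by
          rw [← Set.ncard_eq_toFinset_card']
          exact hdeg x (hXA hx)
      rw [nsmul_eq_mul] at h
      rwa [div_mul_eq_mul_div, mul_div_assoc])
    (by
      intro x hx y hy hxy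
      rw [← Set.toFinset_inter, ← Set.ncard_eq_toFinset_card']
      exact hcodeg x hx y hy hxy)
  have hdiff : (X.card : ℝ) / (4 * k) * (X.card / (4 * k) - 1) * n
      - X.card * (X.card - 1) * (n / (32 * k ^ 2))
      = X.card * n * (X.card - 8 * k + 1) / (32 * k ^ 2) := by
    field_simp
    ring
  have hX0 : (0 : ℝ) < X.card := by linarith
  have hpos : 0 < (X.card : ℝ) * n * (X.card - 8 * k + 1) / (32 * k ^ 2) := by
    have : 0 < (X.card : ℝ) - 8 * k + 1 := by linarith
    positivity
  linarith
end

section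
/- Let k > 0 be a real number and n a positive integer with n ≥ 2^{16}·k^5. Let Γ be a finite graph with the property that every induced subgraph of Γ on v ≥ 16k vertices has more than v²/(32k) edges. Then in every induced subgraph Γ₁ of Γ, the number of vertices whose degree in Γ₁ is at most n/(2^{16}k^5) is at most n/(2^{12}k^4). -/
/-- A finite graph whose degrees are all at most `d` has at most `d * |W| / 2` edges. -/
theorem SimpleGraph.two_mul_ncard_edgeSet_le {W : Type*} [Fintype W] (G : SimpleGraph W) (d : ℝ)
    (h : ∀ w, ((G.neighborSet w).ncard : ℝ) ≤ d) :
    2 * (G.edgeSet.ncard : ℝ) ≤ Fintype.card W * d := by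
  classical
  have hsum := G.sum_degrees_eq_twice_card_edges
  have hcard : G.edgeSet.ncard = G.edgeFinset.card := by
    rw [← G.coe_edgeFinset, Set.ncard_coe_finset]
  have hdeg : ∀ w, G.degree w = (G.neighborSet w).ncard := fun w => by
    rw [← G.card_neighborFinset_eq_degree, ← Set.ncard_coe_finset, G.coe_neighborFinset]
  calc 2 * (G.edgeSet.ncard : ℝ) = ∑ w, (G.degree w : ℝ) := by
        rw [hcard]; exact_mod_cast hsum.symm
    _ ≤ ∑ _w : W, d := Finset.sum_le_sum fun w _ => by rw [hdeg]; exact h w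
    _ = Fintype.card W * d := by simp

/-- The degree of a vertex in an induced subgraph is monotone in the inducing vertex set. -/
theorem SimpleGraph.ncard_neighborSet_induce_le {V : Type*} (G : SimpleGraph V) {T S : Set V}
    (hTS : T ⊆ S) (hS : S.Finite) (w : T) :
    ((G.induce T).neighborSet w).ncard ≤ {y ∈ S | G.Adj w y}.ncard := by
  refine Set.ncard_le_ncard_of_injOn (fun y => (y : V)) ?_ Subtype.val_injective.injOn
    (hS.subset (Set.sep_subset _ _))
  exact fun y hy => ⟨hTS y.2, hy⟩


/-- If every induced subgraph of `Γ` on `v ≥ 16k` vertices has more than `v²/(32k)`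
edges, then (for `n ≥ 2^16 k^5`) in every induced subgraph `Γ₁` of `Γ` at most
`n/(2^12 k^4)` vertices have degree (inside `Γ₁`) at most `n/(2^16 k^5)`. -/
theorem stmt_3 {V : Type} [Fintype V] (k : ℝ) (hk : 0 < k) (n : ℕ) (hn : 0 < n)
    (hnk : 2 ^ 16 * k ^ 5 ≤ (n : ℝ)) (Γ : SimpleGraph V)
    (hdense : ∀ S : Finset V, 16 * k ≤ (S.card : ℝ) →
      ((S.card : ℝ) ^ 2) / (32 * k) < (((Γ.induce (S : Set V)).edgeSet.ncard : ℝ))) :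
    ∀ S : Finset V,
      (({x ∈ (S : Set V) |
          (({y ∈ (S : Set V) | Γ.Adj x y}).ncard : ℝ) ≤ (n : ℝ) / (2 ^ 16 * k ^ 5)}).ncard : ℝ)
        ≤ (n : ℝ) / (2 ^ 12 * k ^ 4) := by
  classical
  intro S
  set d : ℝ := (n : ℝ) / (2 ^ 16 * k ^ 5) with hd
  have hd_one : 1 ≤ d := by rw [hd, le_div_iff₀ (by positivity)]; linarith
  have hbound : (n : ℝ) / (2 ^ 12 * k ^ 4) = 16 * k * d := by
    rw [hd]; field_simp; norm_num
  rw [hbound]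
  set T : Finset V :=
    {x ∈ S | (({y ∈ (S : Set V) | Γ.Adj x y}).ncard : ℝ) ≤ d} with hT
  have hTS : (T : Set V) ⊆ S := by exact_mod_cast Finset.filter_subset _ _
  have hTset : {x ∈ (S : Set V) | (({y ∈ (S : Set V) | Γ.Adj x y}).ncard : ℝ) ≤ d} = T := by
    ext x; simp [hT]
  rw [hTset, Set.ncard_coe_finset]
  by_contra! hlt
  have hedges := (Γ.induce (T : Set V)).two_mul_ncard_edgeSet_le d fun w =>
    (Nat.cast_le.mpr (Γ.ncard_neighborSet_induce_le hTS S.finite_toSet w)).trans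
      (Finset.mem_filter.mp w.2).2
  have hcard : Fintype.card (T : Set V) = T.card := by simp
  rw [hcard] at hedges
  have hdenseT := hdense T (by nlinarith)
  rw [div_lt_iff₀ (by positivity)] at hdenseT
  have hpos : (0 : ℝ) < T.card := lt_trans (by positivity) hlt
  nlinarith [mul_lt_mul_of_pos_left hlt hpos, mul_le_mul_of_nonneg_left hedges hk.le]
end

section
/- Let k > 0 be a real number and n an integer with n > 2^{20}·k^5. Let H be a bipartite graph with vertex classes A and B, where |A| + |B| ≤ n, |B| ≤ |A|, and every vertex of H has degree at least n/(4k). Define the auxiliary graph Γ on vertex set A by joining two vertices of A whenever their codegree in H is at least n/(32k²). Call a vertex w ∈ A bad with respect to a pair {u,v} of vertices of B if w ∈ N_H(u,v) and w has degree at most n/(2^{16}k^5) in the subgraph of Γ induced by N_H(u,v). Then for every pair of vertices u, v ∈ B, the number of vertices w ∈ A that are bad with respect to {u,v} is at most n/(2^{12}k^4). -/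
theorem sq_sum_card_le_card_mul_sum_card_inter {α β : Type*} [DecidableEq β]
    (W : Finset α) (B : Finset β) (N : α → Finset β) (hN : ∀ w ∈ W, N w ⊆ B) :
    (∑ w ∈ W, ((N w).card : ℝ)) ^ 2
      ≤ B.card * ∑ w ∈ W, ∑ z ∈ W, ((N w ∩ N z).card : ℝ) := by
  have card_eq : ∀ s ⊆ B, (s.card : ℝ) = ∑ b ∈ B, if b ∈ s then (1 : ℝ) else 0 := by
    intro s hs
    rw [Finset.sum_boole, Finset.filter_mem_eq_inter, Finset.inter_eq_right.2 hs]
  have h₁ : ∑ w ∈ W, ((N w).card : ℝ) = ∑ b ∈ B, ∑ w ∈ W, if b ∈ N w then (1 : ℝ) else 0 := by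
    rw [Finset.sum_comm]
    exact Finset.sum_congr rfl fun w hw => card_eq _ (hN w hw)
  have h₂ : ∑ w ∈ W, ∑ z ∈ W, ((N w ∩ N z).card : ℝ)
      = ∑ b ∈ B, (∑ w ∈ W, if b ∈ N w then (1 : ℝ) else 0) ^ 2 := by
    simp_rw [sq, Finset.sum_mul_sum]
    conv_rhs => rw [Finset.sum_comm]
    refine Finset.sum_congr rfl fun w hw => ?_
    conv_rhs => rw [Finset.sum_comm]
    refine Finset.sum_congr rfl fun z _ => ?_
    rw [card_eq _ (Finset.inter_subset_left.trans (hN w hw))]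
    refine Finset.sum_congr rfl fun b _ => ?_
    by_cases h : b ∈ N w <;> by_cases h' : b ∈ N z <;> simp [h, h']
  rw [h₁, h₂]
  exact sq_sum_le_card_mul_sum_sq

theorem sum_card_inter_le {α β : Type*} [DecidableEq α] [DecidableEq β]
    (W : Finset α) (N : α → Finset β) {c D : ℝ} (hc : 0 ≤ c) {w : α}
    (hD : ((W.filter fun z => z ≠ w ∧ c ≤ ((N z ∩ N w).card : ℝ)).card : ℝ) ≤ D) :
    ∑ z ∈ W, ((N w ∩ N z).card : ℝ) ≤ (D + 1) * (N w).card + W.card * c := by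
  have hpt : ∀ z ∈ W, ((N w ∩ N z).card : ℝ) ≤ (if z = w then ((N w).card : ℝ) else 0)
      + (if z ≠ w ∧ c ≤ ((N z ∩ N w).card : ℝ) then ((N w).card : ℝ) else 0) + c := by
    intro z _
    have hle : ((N w ∩ N z).card : ℝ) ≤ (N w).card := by
      exact_mod_cast Finset.card_le_card Finset.inter_subset_left
    have hnn : (0 : ℝ) ≤ (N w).card := by positivity
    rw [Finset.inter_comm (N z)]
    split_ifs with h₁ h₂ h₂
    · linarith
    · linarith
    · linarith
    · have := lt_of_not_ge fun h => h₂ ⟨h₁, h⟩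
      linarith
  refine (Finset.sum_le_sum hpt).trans ?_
  rw [Finset.sum_add_distrib, Finset.sum_add_distrib, Finset.sum_const, nsmul_eq_mul,
    ← Finset.sum_filter (fun z => z ≠ w ∧ _), Finset.sum_const, nsmul_eq_mul, Finset.sum_ite_eq']
  have h₁ : (if w ∈ W then ((N w).card : ℝ) else 0) ≤ (N w).card := by
    split_ifs
    · exact le_rfl
    · positivity
  have h₂ := mul_le_mul_of_nonneg_right hD (Nat.cast_nonneg (α := ℝ) (N w).card)
  linarith

theorem le_of_sq_le_of_codegree {k n b S m : ℝ} (hk : 0 < k) (hn : 2 ^ 20 * k ^ 5 < n)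
    (hb : b ≤ n / 2) (hS : 0 ≤ S) (hm : 0 ≤ m) (hmS : m * (n / (4 * k)) ≤ S)
    (h : S ^ 2 ≤ b * ((n / (2 ^ 16 * k ^ 5) + 1) * S + m * (m * (n / (32 * k ^ 2))))) :
    m ≤ n / (2 ^ 12 * k ^ 4) := by
  have hn0 : 0 < n := lt_trans (by positivity) hn
  set D := n / (2 ^ 16 * k ^ 5) with hDdef
  have hD : 16 ≤ D := by
    rw [hDdef, le_div_iff₀ (by positivity)]
    linarith
  have hgoal : n / (2 ^ 12 * k ^ 4) = 16 * k * D := by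
    rw [hDdef]
    field_simp
    norm_num
  rw [hgoal]
  have hquad : m * (m * (n / (32 * k ^ 2))) ≤ S ^ 2 / (2 * n) := by
    have hsq := pow_le_pow_left₀ (by positivity) hmS 2
    calc m * (m * (n / (32 * k ^ 2))) = (m * (n / (4 * k))) ^ 2 / (2 * n) := by
          field_simp
          ring
      _ ≤ S ^ 2 / (2 * n) := by gcongr
  have hmain : S ^ 2 ≤ n / 2 * ((D + 1) * S + S ^ 2 / (2 * n)) := by
    refine h.trans (mul_le_mul hb (by linarith) (by positivity) (by positivity))
  have hexp : n / 2 * ((D + 1) * S + S ^ 2 / (2 * n)) = n / 2 * (D + 1) * S + S ^ 2 / 4 := by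
    field_simp
    ring
  rw [hexp] at hmain
  have hSle : S ≤ 2 / 3 * n * (D + 1) := by
    rcases hS.eq_or_lt with h0 | hpos
    · rw [← h0]
      positivity
    · refine le_of_mul_le_mul_right ?_ hpos
      linarith
  have hmle : m * n ≤ 8 / 3 * k * (D + 1) * n := by
    have := hmS.trans hSle
    rw [← mul_div_assoc, div_le_iff₀ (by positivity)] at this
    linarith
  have := le_of_mul_le_mul_right hmle hn0
  have hkD := mul_le_mul_of_nonneg_left hD hk.le
  linarith

/-- Lemma 3 (deterministic form): in the bipartite graph `H` with classes `A`, `B`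
(min degree `n/(4k)`, `|A|+|B| ≤ n`, `|B| ≤ |A|`, `n > 2^20 k^5`), for every pair of
distinct `u, v ∈ B`, the number of vertices `w ∈ A` that are bad with respect to
`{u,v}` (i.e. `w ∈ N_H(u,v)` and `w` has degree at most `n/(2^16 k^5)` in the
subgraph of the auxiliary graph `Γ` induced on `N_H(u,v)`, where `Γ` joins vertices
of `A` of codegree at least `n/(32k²)`) is at most `n/(2^12 k^4)`. -/
theorem stmt_4 {V : Type} [Fintype V] [DecidableEq V] (k : ℝ) (hk : 0 < k) (n : ℕ)
    (hn : 2 ^ 20 * k ^ 5 < (n : ℝ))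
    (H : SimpleGraph V) (A B : Finset V) (hdisj : Disjoint A B)
    (hbip : ∀ u v : V, H.Adj u v → (u ∈ A ∧ v ∈ B) ∨ (u ∈ B ∧ v ∈ A))
    (hcard : A.card + B.card ≤ n) (hBA : B.card ≤ A.card)
    (hdeg : ∀ v ∈ A ∪ B, (n : ℝ) / (4 * k) ≤ ((H.neighborSet v).ncard : ℝ)) :
    ∀ u ∈ B, ∀ v ∈ B, u ≠ v →
      (({w ∈ (A : Set V) | H.Adj w u ∧ H.Adj w v ∧
          (({z ∈ (A : Set V) | H.Adj z u ∧ H.Adj z v ∧ z ≠ w ∧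
              (n : ℝ) / (32 * k ^ 2) ≤
                ((H.neighborSet z ∩ H.neighborSet w).ncard : ℝ)}).ncard : ℝ)
            ≤ (n : ℝ) / (2 ^ 16 * k ^ 5)}).ncard : ℝ)
        ≤ (n : ℝ) / (2 ^ 12 * k ^ 4) := by
  classical
  intro u _ v _ _
  set c : ℝ := (n : ℝ) / (32 * k ^ 2) with hc
  set D : ℝ := (n : ℝ) / (2 ^ 16 * k ^ 5) with hD
  let N : V → Finset V := fun w => (H.neighborSet w).toFinset
  have hcodeg : ∀ z w, (H.neighborSet z ∩ H.neighborSet w).ncard = (N z ∩ N w).card := by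
    intro z w
    rw [← Set.ncard_coe_finset]
    simp [N]
  have hdegN : ∀ w, (H.neighborSet w).ncard = (N w).card := by
    intro w
    rw [← Set.ncard_coe_finset]
    simp [N]
  simp only [hcodeg]
  set bad : Set V := {w ∈ (A : Set V) | H.Adj w u ∧ H.Adj w v ∧
    (({z ∈ (A : Set V) | H.Adj z u ∧ H.Adj z v ∧ z ≠ w ∧
      c ≤ ((N z ∩ N w).card : ℝ)}).ncard : ℝ) ≤ D} with hbad
  let W : Finset V := bad.toFinset
  have hW : ∀ w ∈ W, w ∈ bad := fun w hw => Set.mem_toFinset.1 hw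
  have hcardW : bad.ncard = W.card := Set.ncard_eq_toFinset_card' bad
  have hNB : ∀ w ∈ W, N w ⊆ B := by
    intro w hw x hx
    have hadj : H.Adj w x := by simpa [N] using hx
    rcases hbip w x hadj with h | h
    · exact h.2
    · exact absurd h.1 (Finset.disjoint_left.1 hdisj (hW w hw).1)
  have hcodegSum : ∀ w ∈ W, ∑ z ∈ W, ((N w ∩ N z).card : ℝ)
      ≤ (D + 1) * (N w).card + W.card * c := by
    intro w hw
    refine sum_card_inter_le W N (by positivity) (le_trans ?_ (hW w hw).2.2.2)
    rw [← Set.ncard_coe_finset]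
    refine Nat.cast_le.2 (Set.ncard_le_ncard ?_ (Set.toFinite _))
    intro z hz
    obtain ⟨hzW, hzw⟩ := Finset.mem_filter.1 (Finset.mem_coe.1 hz)
    have hzbad := hW z hzW
    exact ⟨hzbad.1, hzbad.2.1, hzbad.2.2.1, hzw⟩
  rw [hcardW]
  refine le_of_sq_le_of_codegree (b := B.card) (S := ∑ w ∈ W, ((N w).card : ℝ)) hk hn ?_
    (Finset.sum_nonneg fun w _ => Nat.cast_nonneg _) (Nat.cast_nonneg _) ?_ ?_
  · have h₁ : (A.card : ℝ) + B.card ≤ n := by exact_mod_cast hcard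
    have h₂ : (B.card : ℝ) ≤ A.card := by exact_mod_cast hBA
    linarith
  · rw [← nsmul_eq_mul]
    refine Finset.card_nsmul_le_sum _ _ _ fun w hw => ?_
    rw [← hdegN]
    exact hdeg w (Finset.mem_union_left _ (hW w hw).1)
  · refine (sq_sum_card_le_card_mul_sum_card_inter W B N hNB).trans ?_
    refine mul_le_mul_of_nonneg_left ((Finset.sum_le_sum hcodegSum).trans_eq ?_) (by positivity)
    rw [Finset.sum_add_distrib, ← Finset.mul_sum, Finset.sum_const, nsmul_eq_mul]
end

section
/- Let k > 0 be a real number and n an integer with n > 2^{20}·k^5. Let G' be a bipartite graph with vertex classes A' and B' such that: (i) every vertex of A' has degree at least n/(2^6 k²) in G'; and (ii) for every vertex v ∈ B', the number of vertices u ∈ B' such that v and u have fewer than n/(2^{16}k^5) common neighbors in A' is less than n/(2^7 k²). Then every pair of vertex-disjoint edges of G' lies together on a cycle of G' of length at most 8. -/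
namespace SimpleGraph

variable {V : Type*} {G : SimpleGraph V}

/-- The edges `ab` and `a'b'` lie together on a cycle of length at most `8`. -/
def EdgesOnShortCycle (G : SimpleGraph V) (a b a' b' : V) : Prop :=
  ∃ (v : V) (c : G.Walk v v), c.IsCycle ∧ c.length ≤ 8 ∧ s(a, b) ∈ c.edges ∧ s(a', b') ∈ c.edges

theorem EdgesOnShortCycle.symm {a b a' b' : V} (h : G.EdgesOnShortCycle a' b' a b) :
    G.EdgesOnShortCycle a b a' b' := by
  obtain ⟨v, c, hc, hl, h₁, h₂⟩ := h
  exact ⟨v, c, hc, hl, h₂, h₁⟩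

theorem edgesOnShortCycle_of_four {a b a' b' : V} (h₁ : G.Adj a b) (h₂ : G.Adj b a')
    (h₃ : G.Adj a' b') (h₄ : G.Adj b' a) (ha : a ≠ a') (hb : b ≠ b') :
    G.EdgesOnShortCycle a b a' b' := by
  refine ⟨a, .cons h₁ (.cons h₂ (.cons h₃ (.cons h₄ .nil))), ?_, ?_, ?_, ?_⟩
  · have := h₁.ne; have := h₂.ne; have := h₃.ne; have := h₄.ne
    simp [Walk.cons_isCycle_iff, Walk.cons_isPath_iff]
    grind
  all_goals simp

theorem edgesOnShortCycle_of_six {a b a' b' a₂ b₂ : V} (h₁ : G.Adj a b') (h₂ : G.Adj b' a')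
    (h₃ : G.Adj a' b₂) (h₄ : G.Adj b₂ a₂) (h₅ : G.Adj a₂ b) (h₆ : G.Adj b a)
    (hnd : [a, b', a', b₂, a₂, b].Nodup) :
    G.EdgesOnShortCycle a b a' b' := by
  refine ⟨a, .cons h₁ (.cons h₂ (.cons h₃ (.cons h₄ (.cons h₅ (.cons h₆ .nil))))), ?_, ?_, ?_, ?_⟩
  · simp [Walk.cons_isCycle_iff, Walk.cons_isPath_iff] at hnd ⊢
    grind
  all_goals simp [Sym2.eq_swap]

theorem edgesOnShortCycle_of_eight {a b a' b' a₁ b₁ a₂ b₂ : V} (h₁ : G.Adj a b₁)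
    (h₂ : G.Adj b₁ a₁) (h₃ : G.Adj a₁ b') (h₄ : G.Adj b' a') (h₅ : G.Adj a' b₂)
    (h₆ : G.Adj b₂ a₂) (h₇ : G.Adj a₂ b) (h₈ : G.Adj b a)
    (hnd : [a, b₁, a₁, b', a', b₂, a₂, b].Nodup) :
    G.EdgesOnShortCycle a b a' b' := by
  refine ⟨a, .cons h₁ (.cons h₂ (.cons h₃ (.cons h₄ (.cons h₅ (.cons h₆ (.cons h₇
    (.cons h₈ .nil))))))), ?_, ?_, ?_, ?_⟩
  · simp [Walk.cons_isCycle_iff, Walk.cons_isPath_iff] at hnd ⊢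
    grind
  all_goals simp [Sym2.eq_swap]

end SimpleGraph

theorem exists_mem_notMem_of_card_lt_ncard {V : Type*} {s : Set V} {t : Finset V} {m : ℕ}
    (ht : t.card ≤ m) (hs : m < s.ncard) : ∃ x ∈ s, x ∉ t := by
  simpa using Set.exists_mem_notMem_of_ncard_lt_ncard (s := (t : Set V)) (t := s)
    (by rw [Set.ncard_coe_finset]; omega)


/-- Case 1 of the proof of Theorem 1: in a bipartite graph `G'` with classes `A'`, `B'`
satisfying the degree and codegree properties of Lemma 4, every pair of vertex-disjoint
edges lies together on a cycle of length at most 8. -/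
theorem stmt_7 {V : Type} [Fintype V] (k : ℝ) (hk : 0 < k) (n : ℕ)
    (hn : 2 ^ 20 * k ^ 5 < (n : ℝ))
    (G : SimpleGraph V) (A' B' : Finset V) (hdisj : Disjoint A' B')
    (hbip : ∀ u v : V, G.Adj u v → (u ∈ A' ∧ v ∈ B') ∨ (u ∈ B' ∧ v ∈ A'))
    (hdeg : ∀ a ∈ A', (n : ℝ) / (2 ^ 6 * k ^ 2) ≤ ((G.neighborSet a).ncard : ℝ))
    (hcodeg : ∀ v ∈ B',
      (({u ∈ (B' : Set V) | u ≠ v ∧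
          (({z ∈ (A' : Set V) | G.Adj z u ∧ G.Adj z v}).ncard : ℝ)
            < (n : ℝ) / (2 ^ 16 * k ^ 5)}).ncard : ℝ)
        < (n : ℝ) / (2 ^ 7 * k ^ 2)) :
    ∀ a ∈ A', ∀ b ∈ B', ∀ a' ∈ A', ∀ b' ∈ B',
      G.Adj a b → G.Adj a' b' → a ≠ a' → b ≠ b' →
      ∃ (v : V) (c : G.Walk v v), c.IsCycle ∧ c.length ≤ 8 ∧
        s(a, b) ∈ c.edges ∧ s(a', b') ∈ c.edges := by
  classical
  have hn1 : (1 : ℝ) ≤ n := by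
    have : (0 : ℝ) < n := lt_trans (by positivity) hn
    exact_mod_cast this
  have hD : (4 : ℝ) < n / (2 ^ 6 * k ^ 2) := by
    rw [lt_div_iff₀ (by positivity)]
    rcases lt_or_ge (16 * k) 1 with hx | hx
    · nlinarith
    · have := pow_le_pow_right₀ hx (show 2 ≤ 5 by norm_num)
      nlinarith
  have hT : (16 : ℝ) < n / (2 ^ 16 * k ^ 5) := by
    rw [lt_div_iff₀ (by positivity)]
    linarith
  have hhalf : (n : ℝ) / (2 ^ 7 * k ^ 2) = n / (2 ^ 6 * k ^ 2) / 2 := by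
    field_simp
  have hmem : ∀ a ∈ A', ∀ x, G.Adj a x → x ∈ B' := by
    intro a ha x hx
    rcases hbip a x hx with h | h
    · exact h.2
    · exact absurd h.1 (Finset.disjoint_left.mp hdisj ha)
  -- Among the neighbours of `a`, more than two are `v` itself or share many neighbours with `v`.
  have hgood : ∀ a ∈ A', ∀ v ∈ B', 2 < ({x | G.Adj a x ∧
      (x = v ∨ 16 < ({z ∈ (A' : Set V) | G.Adj z x ∧ G.Adj z v}).ncard)} : Set V).ncard := by
    intro a ha v hv
    have hd := hdeg a ha
    have hc := hcodeg v hv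
    set bad : Set V := {u ∈ (B' : Set V) | u ≠ v ∧
      (({z ∈ (A' : Set V) | G.Adj z u ∧ G.Adj z v}).ncard : ℝ) < (n : ℝ) / (2 ^ 16 * k ^ 5)}
      with hbad
    have hle := Set.ncard_le_ncard_sdiff_add_ncard (G.neighborSet a) bad
    have hsub : G.neighborSet a \ bad ⊆ {x | G.Adj a x ∧
        (x = v ∨ 16 < ({z ∈ (A' : Set V) | G.Adj z x ∧ G.Adj z v}).ncard)} := by
      rintro x ⟨hx, hxb⟩
      refine ⟨hx, or_iff_not_imp_left.mpr fun hxv => ?_⟩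
      have : (16 : ℝ) < ({z ∈ (A' : Set V) | G.Adj z x ∧ G.Adj z v}).ncard := by
        by_contra hlt
        exact hxb ⟨hmem a ha x hx, hxv, by linarith⟩
      exact_mod_cast this
    refine lt_of_lt_of_le ?_ (Set.ncard_le_ncard hsub)
    have hle' : ((G.neighborSet a).ncard : ℝ) ≤ (G.neighborSet a \ bad).ncard + bad.ncard := by
      exact_mod_cast hle
    have : (2 : ℝ) < (G.neighborSet a \ bad).ncard := by linarith
    exact_mod_cast this
  have hne : ∀ a ∈ A', ∀ b ∈ B', a ≠ b := fun a ha b hb h =>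
    Finset.disjoint_left.mp hdisj ha (h ▸ hb)
  have hsix : ∀ a ∈ A', ∀ b ∈ B', ∀ a' ∈ A', ∀ b' ∈ B', G.Adj a b → G.Adj a' b' →
      a ≠ a' → b ≠ b' → G.Adj a b' → G.EdgesOnShortCycle a b a' b' := by
    intro a ha b hb a' ha' b' hb' hab hab' haa hbb h
    by_cases h' : G.Adj a' b
    · exact SimpleGraph.edgesOnShortCycle_of_four hab h'.symm hab' h.symm haa hbb
    obtain ⟨b₂, ⟨h₂, hb₂⟩, hb₂'⟩ := exists_mem_notMem_of_card_lt_ncard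
      (t := {b'}) (by simp) (hgood a' ha' b hb)
    have hb₂b : b₂ ≠ b := by rintro rfl; exact h' h₂
    obtain ⟨a₂, ⟨ha₂, h₃, h₄⟩, ha₂'⟩ := exists_mem_notMem_of_card_lt_ncard
      (t := {a, a'}) (Finset.card_le_two.trans (by norm_num)) (hb₂.resolve_left hb₂b)
    have hb₂B := hmem a' ha' b₂ h₂
    rw [Finset.mem_coe] at ha₂
    refine SimpleGraph.edgesOnShortCycle_of_six h hab'.symm h₂ h₃.symm h₄ hab.symm ?_
    simp at hb₂' ha₂' ⊢
    grind
  intro a ha b hb a' ha' b' hb' hab hab' haa hbb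
  change G.EdgesOnShortCycle a b a' b'
  by_cases h : G.Adj a b'
  · exact hsix a ha b hb a' ha' b' hb' hab hab' haa hbb h
  by_cases h' : G.Adj a' b
  · exact (hsix a' ha' b' hb' a ha b hb hab' hab haa.symm hbb.symm h').symm
  obtain ⟨b₁, ⟨h₁, hb₁⟩, hb₁'⟩ := exists_mem_notMem_of_card_lt_ncard
    (t := {b}) (by simp) (hgood a ha b' hb')
  obtain ⟨b₂, ⟨h₂, hb₂⟩, hb₂'⟩ := exists_mem_notMem_of_card_lt_ncard
    (t := {b', b₁}) Finset.card_le_two (hgood a' ha' b hb)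
  have hb₁b' : b₁ ≠ b' := by rintro rfl; exact h h₁
  have hb₂b : b₂ ≠ b := by rintro rfl; exact h' h₂
  obtain ⟨a₁, ⟨ha₁, h₃, h₄⟩, ha₁'⟩ := exists_mem_notMem_of_card_lt_ncard
    (t := {a, a'}) (Finset.card_le_two.trans (by norm_num)) (hb₁.resolve_left hb₁b')
  obtain ⟨a₂, ⟨ha₂, h₅, h₆⟩, ha₂'⟩ := exists_mem_notMem_of_card_lt_ncard
    (t := {a, a', a₁}) (Finset.card_le_three.trans (by norm_num)) (hb₂.resolve_left hb₂b)
  have hb₁B := hmem a ha b₁ h₁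
  have hb₂B := hmem a' ha' b₂ h₂
  rw [Finset.mem_coe] at ha₁ ha₂
  refine SimpleGraph.edgesOnShortCycle_of_eight h₁ h₃.symm h₄ hab'.symm h₂ h₅.symm h₆ hab.symm ?_
  simp at hb₁' hb₂' ha₁' ha₂' ⊢
  grind
end

section
/- Let k > 0 be a real number and n an integer with n > 2^{20}·k^5. Let G' be a bipartite graph with vertex classes A' and B' such that: (i) every vertex of A' has degree at least n/(2^6 k²) in G'; (ii) for every vertex v ∈ B', the number of vertices u ∈ B' such that v and u have fewer than n/(2^{16}k^5) common neighbors in A' is less than n/(2^7 k²); and |B'| ≥ n/(5k). Then every pair of distinct edges of G' sharing a vertex lies together on a cycle of G' of length at most 6. -/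
/-- Six distinct vertices in cyclic adjacency give a cycle of length six through the two edges at
the first vertex. -/
theorem SimpleGraph.exists_isCycle_of_hexagon {V : Type*} {G : SimpleGraph V} {a b c d e f : V}
    (hab : G.Adj a b) (hbc : G.Adj b c) (hcd : G.Adj c d) (hde : G.Adj d e) (hef : G.Adj e f)
    (hfa : G.Adj f a) (hnd : [a, b, c, d, e, f].Nodup) :
    ∃ (v : V) (w : G.Walk v v), w.IsCycle ∧ w.length ≤ 6 ∧ s(a, b) ∈ w.edges ∧
      s(a, f) ∈ w.edges := by
  refine ⟨a, .cons hab (.cons hbc (.cons hcd (.cons hde (.cons hef (.cons hfa .nil))))),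
    ?_, by simp, by simp, by simp [Sym2.eq_swap]⟩
  rw [SimpleGraph.Walk.cons_isCycle_iff]
  simp only [List.nodup_cons, List.mem_cons, not_or] at hnd
  simp only [SimpleGraph.Walk.isPath_def, SimpleGraph.Walk.support_cons,
    SimpleGraph.Walk.support_nil, SimpleGraph.Walk.edges_cons, SimpleGraph.Walk.edges_nil,
    List.nodup_cons, List.mem_cons, Sym2.eq_iff, not_or]
  grind

/-- A finite set with more than two elements has an element avoiding two given ones. -/
theorem Set.exists_mem_ne_ne_of_two_lt_ncard {α : Type*} [Finite α] {s : Set α}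
    (hs : 2 < s.ncard) (p q : α) : ∃ z ∈ s, z ≠ p ∧ z ≠ q := by
  have hpq : ({p, q} : Set α).ncard < s.ncard := by
    have := Set.ncard_insert_le p {q}
    rw [Set.ncard_singleton] at this
    lia
  obtain ⟨z, hz, hzpq⟩ := Set.exists_mem_notMem_of_ncard_lt_ncard hpq
  exact ⟨z, hz, by simpa using hzpq⟩

theorem two_lt_div_of_pow_lt {k : ℝ} (hk : 0 < k) {n : ℕ} (hn : 2 ^ 20 * k ^ 5 < (n : ℝ)) :
    2 < (n : ℝ) / (2 ^ 7 * k ^ 2) := by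
  have hn1 : (1 : ℝ) ≤ n := by
    have : (0 : ℝ) < n := lt_trans (by positivity) hn
    exact_mod_cast this
  rw [lt_div_iff₀ (by positivity)]
  rcases lt_or_ge k (1 / 16) with h | h
  · nlinarith
  · have h3 : (1 / 16 : ℝ) ^ 3 ≤ k ^ 3 := by gcongr
    have h5 : (1 / 16 : ℝ) ^ 3 * k ^ 2 ≤ k ^ 3 * k ^ 2 := by gcongr
    nlinarith


/-- Cases 2 and 3 of the proof of Theorem 1: in a bipartite graph `G'` with classes
`A'`, `B'` satisfying the properties of Lemma 4 together with `|B'| ≥ n/(5k)`, every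
pair of distinct edges sharing a vertex lies together on a cycle of length at most 6. -/
theorem stmt_8 {V : Type} [Fintype V] (k : ℝ) (hk : 0 < k) (n : ℕ)
    (hn : 2 ^ 20 * k ^ 5 < (n : ℝ))
    (G : SimpleGraph V) (A' B' : Finset V) (hdisj : Disjoint A' B')
    (hbip : ∀ u v : V, G.Adj u v → (u ∈ A' ∧ v ∈ B') ∨ (u ∈ B' ∧ v ∈ A'))
    (hdeg : ∀ a ∈ A', (n : ℝ) / (2 ^ 6 * k ^ 2) ≤ ((G.neighborSet a).ncard : ℝ))
    (hcodeg : ∀ v ∈ B',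
      (({u ∈ (B' : Set V) | u ≠ v ∧
          (({z ∈ (A' : Set V) | G.Adj z u ∧ G.Adj z v}).ncard : ℝ)
            < (n : ℝ) / (2 ^ 16 * k ^ 5)}).ncard : ℝ)
        < (n : ℝ) / (2 ^ 7 * k ^ 2))
    (hB' : (n : ℝ) / (5 * k) ≤ (B'.card : ℝ)) :
    ∀ e₁ ∈ G.edgeSet, ∀ e₂ ∈ G.edgeSet, e₁ ≠ e₂ → (∃ x : V, x ∈ e₁ ∧ x ∈ e₂) →
      ∃ (v : V) (c : G.Walk v v), c.IsCycle ∧ c.length ≤ 6 ∧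
        e₁ ∈ c.edges ∧ e₂ ∈ c.edges := by
  have hx := two_lt_div_of_pow_lt hk hn
  have hc : (2 : ℝ) < (n : ℝ) / (2 ^ 16 * k ^ 5) := by
    rw [lt_div_iff₀ (by positivity)]
    nlinarith [pow_pos hk 5]
  have hmemB {u v : V} (hu : u ∈ A') (h : G.Adj u v) : v ∈ B' :=
    (hbip u v h).elim And.right fun h' => (Finset.disjoint_left.mp hdisj hu h'.1).elim
  have hmemA {u v : V} (hu : u ∈ B') (h : G.Adj u v) : v ∈ A' :=
    (hbip u v h).elim (fun h' => (Finset.disjoint_left.mp hdisj h'.1 hu).elim) And.right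
  have hne {u v : V} (hu : u ∈ A') (hv : v ∈ B') : u ≠ v := fun h =>
    Finset.disjoint_left.mp hdisj hu (h ▸ hv)
  have key {a v : V} (ha : a ∈ A') (hv : v ∈ B') (w : V) :
      ∃ u, G.Adj a u ∧ u ≠ v ∧ u ≠ w ∧
        ∀ p q : V, ∃ z, G.Adj z u ∧ G.Adj z v ∧ z ≠ p ∧ z ≠ q := by
    let bad := {u ∈ (B' : Set V) | u ≠ v ∧
      (({z ∈ (A' : Set V) | G.Adj z u ∧ G.Adj z v}).ncard : ℝ) < (n : ℝ) / (2 ^ 16 * k ^ 5)}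
    have hcard : 2 < (G.neighborSet a \ bad).ncard := by
      have h1 := hdeg a ha
      have h2 : (bad.ncard : ℝ) < (n : ℝ) / (2 ^ 7 * k ^ 2) := hcodeg v hv
      have h3 : ((G.neighborSet a).ncard : ℝ) ≤ (G.neighborSet a \ bad).ncard + bad.ncard := by
        exact_mod_cast Set.ncard_le_ncard_sdiff_add_ncard _ _
      have h4 : (n : ℝ) / (2 ^ 6 * k ^ 2) = 2 * ((n : ℝ) / (2 ^ 7 * k ^ 2)) := by
        field_simp
      have h5 : (2 : ℝ) < (G.neighborSet a \ bad).ncard := by linarith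
      exact_mod_cast h5
    obtain ⟨u, ⟨hau, hub⟩, huv, huw⟩ := Set.exists_mem_ne_ne_of_two_lt_ncard hcard v w
    refine ⟨u, hau, huv, huw, fun p q => ?_⟩
    have hcommon : 2 < ({z ∈ (A' : Set V) | G.Adj z u ∧ G.Adj z v}).ncard := by
      by_contra hlt
      refine hub ⟨hmemB ha hau, huv, lt_of_le_of_lt ?_ hc⟩
      exact_mod_cast not_lt.mp hlt
    obtain ⟨z, hz, hzp, hzq⟩ := Set.exists_mem_ne_ne_of_two_lt_ncard hcommon p q
    exact ⟨z, hz.2.1, hz.2.2, hzp, hzq⟩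
  rintro e₁ he₁ e₂ he₂ hne12 ⟨x, hx₁, hx₂⟩
  obtain ⟨y, rfl⟩ := Sym2.mem_iff_exists.mp hx₁
  obtain ⟨w, rfl⟩ := Sym2.mem_iff_exists.mp hx₂
  rw [SimpleGraph.mem_edgeSet] at he₁ he₂
  have hyw : y ≠ w := fun h => hne12 (by rw [h])
  rcases hbip x y he₁ with ⟨hxA, hyB⟩ | ⟨hxB, hyA⟩
  · have hwB := hmemB hxA he₂
    obtain ⟨_, -, -, -, hz⟩ := key hxA hyB y
    obtain ⟨a₁, -, ha₁y, ha₁x, -⟩ := hz x x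
    have ha₁A := hmemA hyB ha₁y.symm
    obtain ⟨b₁, hab₁, hb₁w, hb₁y, hz⟩ := key ha₁A hwB y
    have hb₁B := hmemB ha₁A hab₁
    obtain ⟨a₂, ha₂b₁, ha₂w, ha₂x, ha₂a₁⟩ := hz x a₁
    have ha₂A := hmemA hwB ha₂w.symm
    refine SimpleGraph.exists_isCycle_of_hexagon he₁ ha₁y.symm hab₁ ha₂b₁.symm ha₂w he₂.symm ?_
    simp only [List.nodup_cons, List.mem_cons, not_or]
    grind
  · have hwA := hmemA hxB he₂
    obtain ⟨b₁, hyb₁, hb₁x, -, -⟩ := key hyA hxB x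
    have hb₁B := hmemB hyA hyb₁
    obtain ⟨b₂, hwb₂, hb₂b₁, hb₂x, hz⟩ := key hwA hb₁B x
    have hb₂B := hmemB hwA hwb₂
    obtain ⟨a₂, ha₂b₂, ha₂b₁, ha₂y, ha₂w⟩ := hz y w
    have ha₂A := hmemA hb₁B ha₂b₁.symm
    refine SimpleGraph.exists_isCycle_of_hexagon he₁ hyb₁ ha₂b₁.symm ha₂b₂ hwb₂.symm he₂.symm ?_
    simp only [List.nodup_cons, List.mem_cons, not_or]
    grind
end

section
/- Let k > 0 be a real number. For every bipartite graph G with vertex classes A and B, with n ≥ 2^{18}·k^5 vertices in total and at least n²/k edges, there exist subsets A' ⊆ A and B' ⊆ B such that the subgraph G' of G induced by A' ∪ B' has at least n²/(2^6 k²) edges, and for every a ∈ A' and b ∈ B' there are at least n²/(2^{24} k^7) paths of length three between a and b in G'. -/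
open Classical in
/-- The vertices of `B` with at least `s` neighbours in `X`. -/
noncomputable def heavyVertices {α β : Type*} (R : α → β → Prop) (B : Finset β) (s : ℝ)
    (X : Finset α) : Finset β :=
  {b ∈ B | s ≤ (({a ∈ X | R a b}).card : ℝ)}

open Classical in
/-- The vertices of `S` having fewer than `t` common neighbours with `a` among the vertices of `B`
that have at least `s` neighbours in `X`. -/
noncomputable def poorPartners {α β : Type*} (R : α → β → Prop) (B : Finset β) (s t : ℝ)
    (X S : Finset α) (a : α) : Finset α :=
  {a₁ ∈ S | (({b ∈ heavyVertices R B s X | R a b ∧ R a₁ b}).card : ℝ) < t}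

lemma heavyVertices_mono {α β : Type*} (R : α → β → Prop) (B : Finset β) (s : ℝ)
    {X X' : Finset α} (h : X ⊆ X') : heavyVertices R B s X ⊆ heavyVertices R B s X' := by
  classical
  intro b hb
  simp only [heavyVertices, Finset.mem_filter] at hb ⊢
  refine ⟨hb.1, hb.2.trans ?_⟩
  exact_mod_cast Finset.card_le_card (Finset.filter_subset_filter _ h)

lemma poorPartners_subset {α β : Type*} (R : α → β → Prop) (B : Finset β) (s t : ℝ)
    {X X' S S' : Finset α} (h : X ⊆ X') (hS : S' ⊆ S) (a : α) :
    poorPartners R B s t X' S' a ⊆ poorPartners R B s t X S a := by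
  classical
  intro a₁ ha
  simp only [poorPartners, Finset.mem_filter] at ha ⊢
  refine ⟨hS ha.1, lt_of_le_of_lt ?_ ha.2⟩
  exact_mod_cast Finset.card_le_card (Finset.filter_subset_filter _ (heavyVertices_mono R B s h))

/-- Deleting vertices with many poor partners from `S` one at a time either stops at a set in which
every vertex has few poor partners, or reaches size about `x₀`. -/
lemma exists_pruned_subset {α β : Type*} (R : α → β → Prop) (B : Finset β) (s t u x₀ : ℝ)
    (S : Finset α) (hS : x₀ ≤ (S.card : ℝ)) :
    ∃ X ⊆ S, x₀ ≤ (X.card : ℝ) ∧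
      ((∀ a ∈ X, ((poorPartners R B s t X X a).card : ℝ) < u) ∨
        ((X.card : ℝ) ≤ x₀ + 1 ∧
          ∀ a ∈ S, a ∉ X → u ≤ ((poorPartners R B s t X S a).card : ℝ))) := by
  classical
  let P : Finset α → Prop := fun X => x₀ ≤ (X.card : ℝ) ∧
    ∀ a ∈ S, a ∉ X → u ≤ ((poorPartners R B s t X S a).card : ℝ)
  have hne : (S.powerset.filter P).Nonempty :=
    ⟨S, by simp only [Finset.mem_filter, Finset.mem_powerset]
           exact ⟨subset_rfl, hS, fun a ha hn => absurd ha hn⟩⟩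
  obtain ⟨X, hX, hmin⟩ := Finset.exists_min_image _ Finset.card hne
  simp only [Finset.mem_filter, Finset.mem_powerset] at hX hmin
  obtain ⟨hXS, hx, hout⟩ := hX
  refine ⟨X, hXS, hx, ?_⟩
  by_contra hcon
  rw [not_or] at hcon
  obtain ⟨h1, h2⟩ := hcon
  push Not at h1
  obtain ⟨a, haX, hau⟩ := h1
  have hbig : x₀ + 1 < (X.card : ℝ) := by
    by_contra h
    exact h2 ⟨not_lt.mp h, hout⟩
  have hc := Finset.card_erase_add_one haX
  have hcr : ((X.erase a).card : ℝ) + 1 = (X.card : ℝ) := by exact_mod_cast hc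
  have := hmin (X.erase a) ⟨(Finset.erase_subset _ _).trans hXS, by linarith, ?_⟩
  · omega
  · intro a' ha'S ha'
    have hle : ∀ Z : Finset α, Z ⊆ S → ((poorPartners R B s t X Z a').card : ℝ) ≤
        ((poorPartners R B s t (X.erase a) S a').card : ℝ) := fun Z hZ => by
      exact_mod_cast Finset.card_le_card
        (poorPartners_subset R B s t (Finset.erase_subset a X) hZ a')
    by_cases haa : a' = a
    · subst haa
      exact hau.trans (hle X hXS)
    · exact (hout a' ha'S fun h => ha' (Finset.mem_erase.mpr ⟨haa, h⟩)).trans (hle S subset_rfl)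

open Classical in
/-- If each `b₀ ∈ Q` comes with a set `X b₀` of about `x₀` of its neighbours, and few `b ∈ Q` have
many neighbours in `X b₀`, then `Q` is small. -/
lemma card_mul_sq_le_of_few_heavy {α β : Type*} (R : α → β → Prop) (A : Finset α) (Q : Finset β)
    (X : β → Finset α) (n s t x₀ x₁ : ℝ) (hA : (A.card : ℝ) ≤ n) (hx₀ : 0 ≤ x₀)
    (hs : 2 * n * s ≤ x₀ ^ 2) (hs₀ : 0 ≤ s) (hx₁ : 0 ≤ x₁) (ht : 0 ≤ t)
    (hXA : ∀ b ∈ Q, X b ⊆ A) (hXR : ∀ b ∈ Q, ∀ a ∈ X b, R a b)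
    (hXlow : ∀ b ∈ Q, x₀ ≤ ((X b).card : ℝ)) (hXup : ∀ b ∈ Q, ((X b).card : ℝ) ≤ x₁)
    (hfew : ∀ b₀ ∈ Q, ((heavyVertices R Q s (X b₀)).card : ℝ) ≤ t) :
    (Q.card : ℝ) * x₀ ^ 2 ≤ 2 * n * (t * x₁) := by
  have hn : 0 ≤ n := (Nat.cast_nonneg _).trans hA
  let f : α → ℝ := fun a => (({b ∈ Q | a ∈ X b}).card : ℝ)
  let g : α → ℝ := fun a => (({b ∈ Q | R a b}).card : ℝ)
  have hfg : ∀ a, f a ≤ g a := fun a => by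
    simp only [f, g]
    norm_cast
    refine Finset.card_le_card fun b hb => ?_
    simp only [Finset.mem_filter] at hb ⊢
    exact ⟨hb.1, hXR b hb.1 a hb.2⟩
  have hf0 : ∀ a, 0 ≤ f a := fun a => Nat.cast_nonneg _
  have hsum : ∑ a ∈ A, f a = ∑ b ∈ Q, ((X b).card : ℝ) := by
    simp only [f, Finset.card_filter, Nat.cast_sum]
    rw [Finset.sum_comm]
    refine Finset.sum_congr rfl fun b hb => ?_
    rw [← Nat.cast_sum, ← Finset.card_filter, Finset.filter_mem_eq_inter,
      Finset.inter_eq_right.mpr (hXA b hb)]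
  have hlow : (Q.card : ℝ) * x₀ ≤ ∑ a ∈ A, f a := by
    rw [hsum, ← nsmul_eq_mul]
    exact Finset.card_nsmul_le_sum _ _ _ hXlow
  have hprod : ∑ a ∈ A, f a * g a = ∑ b₀ ∈ Q, ∑ b ∈ Q, (({a ∈ X b₀ | R a b}).card : ℝ) := by
    simp only [f, g, Finset.card_filter, Nat.cast_sum, Finset.sum_mul_sum]
    rw [Finset.sum_comm]
    refine Finset.sum_congr rfl fun b₀ hb₀ => ?_
    rw [Finset.sum_comm]
    refine Finset.sum_congr rfl fun b _ => ?_
    rw [← Finset.inter_eq_right.mpr (hXA b₀ hb₀), ← Finset.filter_mem_eq_inter, Finset.sum_filter]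
    refine Finset.sum_congr rfl fun a ha => ?_
    by_cases h : a ∈ X b₀ <;> simp [h, ha]
  have hinner : ∀ b₀ ∈ Q, ∑ b ∈ Q, (({a ∈ X b₀ | R a b}).card : ℝ) ≤
      t * x₁ + (Q.card : ℝ) * s := by
    intro b₀ hb₀
    calc ∑ b ∈ Q, (({a ∈ X b₀ | R a b}).card : ℝ)
        ≤ ∑ b ∈ Q, ((if s ≤ (({a ∈ X b₀ | R a b}).card : ℝ) then x₁ else 0) + s) := by
          refine Finset.sum_le_sum fun b _ => ?_
          split_ifs with h
          · have : (({a ∈ X b₀ | R a b}).card : ℝ) ≤ ((X b₀).card : ℝ) := by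
              exact_mod_cast Finset.card_filter_le _ _
            linarith [hXup b₀ hb₀]
          · linarith [not_le.mp h]
      _ = ((heavyVertices R Q s (X b₀)).card : ℝ) * x₁ + (Q.card : ℝ) * s := by
          rw [Finset.sum_add_distrib, ← Finset.sum_filter, Finset.sum_const, Finset.sum_const,
            nsmul_eq_mul, nsmul_eq_mul]
          rfl
      _ ≤ _ := by
          have := mul_le_mul_of_nonneg_right (hfew b₀ hb₀) hx₁
          linarith
  have hupper : ∑ a ∈ A, f a * g a ≤ (Q.card : ℝ) * (t * x₁ + (Q.card : ℝ) * s) := by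
    rw [hprod, ← nsmul_eq_mul]
    exact Finset.sum_le_card_nsmul _ _ _ hinner
  have hcs : (∑ a ∈ A, f a) ^ 2 ≤ (A.card : ℝ) * ∑ a ∈ A, f a ^ 2 := sq_sum_le_card_mul_sum_sq
  have hff : ∑ a ∈ A, f a ^ 2 ≤ ∑ a ∈ A, f a * g a :=
    Finset.sum_le_sum fun a _ => by
      rw [sq]
      exact mul_le_mul_of_nonneg_left (hfg a) (hf0 a)
  have hff0 : 0 ≤ ∑ a ∈ A, f a ^ 2 := Finset.sum_nonneg fun a _ => sq_nonneg _
  have hQ0 : (0 : ℝ) ≤ Q.card := Nat.cast_nonneg _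
  have hmain : ((Q.card : ℝ) * x₀) ^ 2 ≤ n * ((Q.card : ℝ) * (t * x₁ + (Q.card : ℝ) * s)) :=
    calc ((Q.card : ℝ) * x₀) ^ 2 ≤ (∑ a ∈ A, f a) ^ 2 :=
          pow_le_pow_left₀ (mul_nonneg hQ0 hx₀) hlow 2
      _ ≤ (A.card : ℝ) * ∑ a ∈ A, f a ^ 2 := hcs
      _ ≤ n * ∑ a ∈ A, f a ^ 2 := mul_le_mul_of_nonneg_right hA hff0
      _ ≤ _ := mul_le_mul_of_nonneg_left (hff.trans hupper) hn
  rcases hQ0.eq_or_lt with h | h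
  · rw [← h, zero_mul]
    positivity
  · have h1 : (Q.card : ℝ) ^ 2 * (2 * n * s) ≤ (Q.card : ℝ) ^ 2 * x₀ ^ 2 := by gcongr
    have h2 : (Q.card : ℝ) * ((Q.card : ℝ) * x₀ ^ 2) ≤ (Q.card : ℝ) * (2 * n * (t * x₁)) := by
      linarith
    exact le_of_mul_le_mul_left h2 h

open Classical in
/-- A dense bipartite relation has a large set `X ⊆ A` in which every vertex has few poor
partners. -/
lemma exists_few_poorPartners {α β : Type*} (R : α → β → Prop) (A : Finset α) (B : Finset β)
    (n s t u x₀ x₁ : ℝ) (hA : (A.card : ℝ) ≤ n) (hx₀ : 0 < x₀) (hs : 2 * n * s ≤ x₀ ^ 2)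
    (hs₀ : 0 ≤ s) (hx₁ : x₀ + 1 ≤ x₁) (ht : 0 ≤ t) (hu : 0 ≤ u)
    (hdense : n ^ 2 * (2 * n * (t * x₁)) <
      x₀ ^ 2 * (u * ((∑ b ∈ B, (({a ∈ A | R a b}).card : ℝ)) - B.card * x₁))) :
    ∃ X ⊆ A, x₀ ≤ (X.card : ℝ) ∧
      ∀ a ∈ X, ((poorPartners R B s t X X a).card : ℝ) < u := by
  have hn : 0 ≤ n := (Nat.cast_nonneg _).trans hA
  by_contra hcon
  push Not at hcon
  let N : β → Finset α := fun b => {a ∈ A | R a b}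
  let B₁ : Finset β := {b ∈ B | x₀ ≤ ((N b).card : ℝ)}
  have hex : ∀ b : β, ∃ X : Finset α, b ∈ B₁ → X ⊆ N b ∧ x₀ ≤ (X.card : ℝ) ∧
      (X.card : ℝ) ≤ x₁ ∧
      ∀ a ∈ N b, a ∉ X → u ≤ ((poorPartners R B s t X (N b) a).card : ℝ) := by
    intro b
    by_cases hb : b ∈ B₁
    · have hb' := (Finset.mem_filter.mp hb).2
      obtain ⟨X, hXN, hX, h | h⟩ := exists_pruned_subset R B s t u x₀ (N b) hb'
      · obtain ⟨a, ha, hau⟩ := hcon X (hXN.trans (Finset.filter_subset _ _)) hX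
        exact absurd (h a ha) (not_lt.mpr hau)
      · exact ⟨X, fun _ => ⟨hXN, hX, h.1.trans hx₁, h.2⟩⟩
    · exact ⟨∅, fun h => absurd h hb⟩
  choose X hX using hex
  let D : β → α → α → Prop := fun b a a₁ =>
    R a b ∧ a₁ ∈ poorPartners R B s t (X b) (N b) a
  have hupper : ∀ a ∈ A, ∀ a₁ ∈ A,
      (({b ∈ B₁ | D b a a₁}).card : ℝ) * x₀ ^ 2 ≤ 2 * n * (t * x₁) := by
    intro a _ a₁ _
    have hB₁ : ∀ b ∈ ({b ∈ B₁ | D b a a₁} : Finset β), b ∈ B₁ :=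
      fun b hb => (Finset.mem_filter.mp hb).1
    refine card_mul_sq_le_of_few_heavy R A _ X n s t x₀ x₁ hA hx₀.le hs hs₀ (by linarith) ht
      (fun b hb => ((hX b (hB₁ b hb)).1).trans (Finset.filter_subset _ _))
      (fun b hb a' ha' => (Finset.mem_filter.mp ((hX b (hB₁ b hb)).1 ha')).2)
      (fun b hb => (hX b (hB₁ b hb)).2.1) (fun b hb => (hX b (hB₁ b hb)).2.2.1) ?_
    intro b₀ hb₀
    have hD := (Finset.mem_filter.mp hb₀).2.2
    refine le_trans ?_ (Finset.mem_filter.mp hD).2.le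
    norm_cast
    refine Finset.card_le_card fun b hb => ?_
    simp only [heavyVertices, Finset.mem_filter, D, B₁, poorPartners, N] at hb ⊢
    exact ⟨⟨hb.1.1.1, hb.2⟩, hb.1.2.1, (Finset.mem_filter.mp (Finset.mem_filter.mp hb.1.2.2).1).2⟩
  have hT : ∑ a ∈ A, ∑ a₁ ∈ A, (({b ∈ B₁ | D b a a₁}).card : ℝ) =
      ∑ b ∈ B₁, ∑ a ∈ N b, ((poorPartners R B s t (X b) (N b) a).card : ℝ) := by
    simp only [Finset.card_filter, Nat.cast_sum]
    have : ∀ a ∈ A, ∑ a₁ ∈ A, ∑ b ∈ B₁, (((if D b a a₁ then 1 else 0 : ℕ)) : ℝ) =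
        ∑ b ∈ B₁, ∑ a₁ ∈ A, (((if D b a a₁ then 1 else 0 : ℕ)) : ℝ) :=
      fun a _ => Finset.sum_comm
    rw [Finset.sum_congr rfl this, Finset.sum_comm]
    refine Finset.sum_congr rfl fun b _ => ?_
    rw [Finset.sum_filter]
    refine Finset.sum_congr rfl fun a _ => ?_
    by_cases h : R a b
    · simp only [D, h, true_and, if_true]
      rw [← Nat.cast_sum, ← Finset.card_filter]
      congr 2
      rw [Finset.filter_mem_eq_inter, Finset.inter_eq_right]
      exact (Finset.filter_subset _ _).trans (Finset.filter_subset _ _)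
    · simp [D, h]
  have hTup : (∑ a ∈ A, ∑ a₁ ∈ A, (({b ∈ B₁ | D b a a₁}).card : ℝ)) * x₀ ^ 2 ≤
      n ^ 2 * (2 * n * (t * x₁)) := by
    have hnn : 0 ≤ 2 * n * (t * x₁) := by
      have : 0 ≤ x₁ := by linarith
      positivity
    rw [Finset.sum_mul]
    calc ∑ a ∈ A, (∑ a₁ ∈ A, (({b ∈ B₁ | D b a a₁}).card : ℝ)) * x₀ ^ 2
        ≤ ∑ a ∈ A, (A.card : ℝ) * (2 * n * (t * x₁)) := by
          refine Finset.sum_le_sum fun a ha => ?_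
          rw [Finset.sum_mul, ← nsmul_eq_mul]
          exact Finset.sum_le_card_nsmul _ _ _ (hupper a ha)
      _ = (A.card : ℝ) ^ 2 * (2 * n * (t * x₁)) := by
          rw [Finset.sum_const, nsmul_eq_mul]; ring
      _ ≤ _ := by gcongr
  have hTlow : u * ((∑ b ∈ B, ((N b).card : ℝ)) - B.card * x₁) ≤
      ∑ b ∈ B₁, ∑ a ∈ N b, ((poorPartners R B s t (X b) (N b) a).card : ℝ) := by
    have h1 : (∑ b ∈ B, ((N b).card : ℝ)) - B.card * x₁ ≤
        ∑ b ∈ B₁, (((N b).card : ℝ) - (X b).card) := by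
      rw [← nsmul_eq_mul, ← Finset.sum_const, ← Finset.sum_sub_distrib, Finset.sum_filter]
      refine Finset.sum_le_sum fun b hb => ?_
      split_ifs with h
      · have := (hX b (Finset.mem_filter.mpr ⟨hb, h⟩)).2.2.1
        linarith
      · linarith [not_le.mp h]
    refine (mul_le_mul_of_nonneg_left h1 hu).trans ?_
    rw [Finset.mul_sum]
    refine Finset.sum_le_sum fun b hb => ?_
    obtain ⟨hXN, -, -, hp⟩ := hX b hb
    rw [← Nat.cast_sub (Finset.card_le_card hXN), ← Finset.card_sdiff_of_subset hXN, mul_comm,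
      ← nsmul_eq_mul]
    refine (Finset.card_nsmul_le_sum _ _ _ fun a ha => ?_).trans
      (Finset.sum_le_sum_of_subset_of_nonneg (Finset.sdiff_subset (t := X b))
        fun _ _ _ => Nat.cast_nonneg _)
    rw [Finset.mem_sdiff] at ha
    exact hp a ha.1 ha.2
  rw [hT] at hTup
  have := mul_le_mul_of_nonneg_left hTlow (sq_nonneg x₀)
  linarith

open Classical in
/-- Within a set `X` all of whose vertices have few poor partners, every vertex is joined to every
heavy vertex by many paths of length three. -/
lemma paths_of_few_poorPartners {α β : Type*} (R : α → β → Prop) (B : Finset β) (s t u : ℝ)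
    (X : Finset α) (hX : ∀ a ∈ X, ((poorPartners R B s t X X a).card : ℝ) < u) (ht : 1 ≤ t)
    {a : α} (ha : a ∈ X) {b : β} (hb : b ∈ heavyVertices R B s X) :
    (s - u - 1) * (t - 1) ≤
      (({p ∈ heavyVertices R B s X ×ˢ X | p.1 ≠ b ∧ p.2 ≠ a ∧
        R a p.1 ∧ R p.2 p.1 ∧ R p.2 b}).card : ℝ) := by
  let Y := heavyVertices R B s X
  let U : Finset α := (({a₁ ∈ X | R a₁ b} : Finset α) \ poorPartners R B s t X X a).erase a
  have hU : s - u - 1 ≤ (U.card : ℝ) := by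
    have h1 := (Finset.mem_filter.mp hb).2
    have h2 : (({a₁ ∈ X | R a₁ b} : Finset α)).card ≤
        (poorPartners R B s t X X a).card + (U.card + 1) :=
      calc _ ≤ (poorPartners R B s t X X a).card +
            (({a₁ ∈ X | R a₁ b} : Finset α) \ poorPartners R B s t X X a).card := by
            rw [add_comm]; exact Finset.card_le_card_sdiff_add_card
        _ ≤ _ := by
            gcongr
            have := Finset.pred_card_le_card_erase
              (s := ({a₁ ∈ X | R a₁ b} : Finset α) \ poorPartners R B s t X X a) (a := a)
            simp only [U]
            omega
    have h3 : (({a₁ ∈ X | R a₁ b} : Finset α).card : ℝ) ≤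
        (poorPartners R B s t X X a).card + (U.card + 1) := by exact_mod_cast h2
    linarith [hX a ha]
  have hcount : ∀ a₁ ∈ U, t - 1 ≤ (((({b₁ ∈ Y | R a b₁ ∧ R a₁ b₁} : Finset β)).erase b).card : ℝ) := by
    intro a₁ h
    simp only [U, Finset.mem_erase, Finset.mem_sdiff, Finset.mem_filter, poorPartners, not_and,
      not_lt] at h
    have h1 := h.2.2 h.2.1.1
    have h2 := Finset.pred_card_le_card_erase
      (s := ({b₁ ∈ Y | R a b₁ ∧ R a₁ b₁} : Finset β)) (a := b)
    have h3 : (({b₁ ∈ Y | R a b₁ ∧ R a₁ b₁} : Finset β).card : ℝ) ≤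
        ((({b₁ ∈ Y | R a b₁ ∧ R a₁ b₁} : Finset β).erase b).card : ℝ) + 1 := by
      exact_mod_cast (by omega : _ ≤ (({b₁ ∈ Y | R a b₁ ∧ R a₁ b₁} : Finset β).erase b).card + 1)
    linarith
  calc (s - u - 1) * (t - 1) ≤ (U.card : ℝ) * (t - 1) := by
        gcongr
    _ ≤ ∑ a₁ ∈ U, (((({b₁ ∈ Y | R a b₁ ∧ R a₁ b₁} : Finset β)).erase b).card : ℝ) := by
        rw [← nsmul_eq_mul]
        exact Finset.card_nsmul_le_sum _ _ _ hcount
    _ = ((U.sigma fun a₁ => (({b₁ ∈ Y | R a b₁ ∧ R a₁ b₁} : Finset β)).erase b).card : ℝ) := by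
        rw [Finset.card_sigma, Nat.cast_sum]
    _ ≤ _ := by
        norm_cast
        refine Finset.card_le_card_of_injOn (fun p => (p.2, p.1)) ?_ ?_
        · rintro ⟨a₁, b₁⟩ h
          simp only [U, Finset.coe_sigma, Set.mem_sigma_iff, Finset.mem_coe, Finset.mem_erase,
            Finset.mem_sdiff, Finset.mem_filter, Finset.mem_product] at h ⊢
          exact ⟨⟨h.2.2.1, h.1.2.1.1⟩, h.2.1, h.1.1, h.2.2.2.1, h.2.2.2.2, h.1.2.1.2⟩
        · rintro ⟨a₁, b₁⟩ - ⟨a₂, b₂⟩ - h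
          simp only [Prod.mk.injEq] at h
          obtain ⟨rfl, rfl⟩ := h
          rfl

open Classical in
/-- A dense bipartite relation contains an induced subrelation with many edges in which any two
vertices of different classes are joined by many paths of length three. -/
lemma exists_dense_three_path_connected {α β : Type*} (R : α → β → Prop) (A : Finset α)
    (B : Finset β) (k n : ℝ) (hk : 1 ≤ k) (hA : (A.card : ℝ) ≤ n) (hB : (B.card : ℝ) ≤ n)
    (hnk : 2 ^ 18 * k ^ 5 ≤ n)
    (hedges : n ^ 2 / k ≤ (({p ∈ A ×ˢ B | R p.1 p.2}).card : ℝ)) :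
    ∃ X ⊆ A, ∃ Y ⊆ B,
      n ^ 2 / (2 ^ 6 * k ^ 2) ≤ (({p ∈ X ×ˢ Y | R p.1 p.2}).card : ℝ) ∧
      ∀ a ∈ X, ∀ b ∈ Y,
        n ^ 2 / (2 ^ 24 * k ^ 7) ≤
          (({p ∈ Y ×ˢ X | p.1 ≠ b ∧ p.2 ≠ a ∧ R a p.1 ∧ R p.2 p.1 ∧ R p.2 b}).card : ℝ) := by
  have hk0 : 0 < k := by linarith
  have hn0 : 0 < n := lt_of_lt_of_le (by positivity) hnk
  obtain ⟨D, hD⟩ : ∃ D, D = n / k := ⟨_, rfl⟩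
  have hnD : n = D * k := by rw [hD]; field_simp
  have hD0 : 0 < D := by rw [hD]; positivity
  have hDk : 2 ^ 18 * k ^ 4 ≤ D := by
    rw [hD, le_div_iff₀ hk0]
    linarith
  have hk4 : 1 ≤ k ^ 4 := one_le_pow₀ hk
  have hD4 : 4 ≤ D := by linarith
  let A₁ : Finset α := {a ∈ A | D / 4 ≤ (({b ∈ B | R a b}).card : ℝ)}
  have hA₁ : (A₁.card : ℝ) ≤ n := by
    refine le_trans ?_ hA
    exact_mod_cast Finset.card_filter_le _ _
  have hcount : ∀ (S : Finset α) (T : Finset β), (({p ∈ S ×ˢ T | R p.1 p.2}).card : ℝ) =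
      ∑ a ∈ S, (({b ∈ T | R a b}).card : ℝ) := by
    intro S T
    simp only [Finset.card_filter, Nat.cast_sum]
    rw [Finset.sum_product]
  have hcomm : ∀ (S : Finset α) (T : Finset β), ∑ a ∈ S, (({b ∈ T | R a b}).card : ℝ) =
      ∑ b ∈ T, (({a ∈ S | R a b}).card : ℝ) := by
    intro S T
    simp only [Finset.card_filter, Nat.cast_sum]
    exact Finset.sum_comm
  have he₁ : 3 / 4 * (n * D) ≤ ∑ b ∈ B, (({a ∈ A₁ | R a b}).card : ℝ) := by
    rw [← hcomm]
    have h1 : ∑ a ∈ A, (({b ∈ B | R a b}).card : ℝ) ≤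
        ∑ a ∈ A₁, (({b ∈ B | R a b}).card : ℝ) + A.card * (D / 4) := by
      rw [← nsmul_eq_mul, ← Finset.sum_const, Finset.sum_filter, ← Finset.sum_add_distrib]
      refine Finset.sum_le_sum fun a _ => ?_
      split_ifs with h
      · linarith
      · linarith [not_le.mp h]
    have h2 : (A.card : ℝ) * (D / 4) ≤ n * (D / 4) := by gcongr
    have h3 : n ^ 2 / k = n * D := by rw [hD]; ring
    rw [hcount, h3] at hedges
    linarith
  obtain ⟨s, hs⟩ : ∃ s, s = D ^ 2 / (32 * n) := ⟨_, rfl⟩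
  obtain ⟨t, ht⟩ : ∃ t, t = n / (2 ^ 14 * k ^ 4) := ⟨_, rfl⟩
  have hs0 : 0 < s := by rw [hs]; positivity
  have hsn : s * n = D ^ 2 / 32 := by rw [hs]; field_simp
  have ht0 : 0 < t := by rw [ht]; positivity
  have htD : t * 2 ^ 14 * n ^ 3 = D ^ 4 := by
    rw [ht, hnD]; field_simp
  have ht2 : 2 ≤ t := by
    rw [ht, le_div_iff₀ (by positivity)]
    nlinarith
  have hs8 : 4 ≤ s := by
    have : s = D / (32 * k) := by rw [hs, hnD]; field_simp
    rw [this, le_div_iff₀ (by positivity)]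
    have : k ≤ k ^ 4 := le_self_pow₀ hk (by norm_num)
    linarith
  obtain ⟨X, hXA₁, hXc, hX⟩ := exists_few_poorPartners R A₁ B n s t (s / 4) (D / 4) (D / 2) hA₁
    (by positivity) (by nlinarith) hs0.le (by linarith) ht0.le (by positivity) (by
      have h1 : n * D / 4 ≤ (∑ b ∈ B, (({a ∈ A₁ | R a b}).card : ℝ)) - B.card * (D / 2) := by
        have : (B.card : ℝ) * (D / 2) ≤ n * (D / 2) := by gcongr
        linarith
      calc n ^ 2 * (2 * n * (t * (D / 2))) = D ^ 5 / 2 ^ 14 := by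
            have : n ^ 2 * (2 * n * (t * (D / 2))) = (t * 2 ^ 14 * n ^ 3) * D / 2 ^ 14 := by ring
            rw [this, htD]; ring
        _ < D ^ 5 / 2 ^ 13 := by
            have : 0 < D ^ 5 := by positivity
            linarith
        _ = (D / 4) ^ 2 * (s / 4 * (n * D / 4)) := by
            have : (D / 4) ^ 2 * (s / 4 * (n * D / 4)) = (s * n) * D ^ 3 / 256 := by ring
            rw [this, hsn]; ring
        _ ≤ _ := by gcongr)
  refine ⟨X, hXA₁.trans (Finset.filter_subset _ _), heavyVertices R B s X,
    Finset.filter_subset _ _, ?_, ?_⟩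
  · have h1 : (X.card : ℝ) * (D / 4) ≤ ∑ b ∈ B, (({a ∈ X | R a b}).card : ℝ) := by
      rw [← hcomm, ← nsmul_eq_mul]
      exact Finset.card_nsmul_le_sum _ _ _ fun a ha => (Finset.mem_filter.mp (hXA₁ ha)).2
    have h2 : ∑ b ∈ B, (({a ∈ X | R a b}).card : ℝ) ≤
        ∑ b ∈ heavyVertices R B s X, (({a ∈ X | R a b}).card : ℝ) + B.card * s := by
      rw [← nsmul_eq_mul, ← Finset.sum_const, heavyVertices, Finset.sum_filter,
        ← Finset.sum_add_distrib]
      refine Finset.sum_le_sum fun b _ => ?_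
      split_ifs with h
      · linarith
      · linarith [not_le.mp h]
    have h3 : (B.card : ℝ) * s ≤ n * s := by gcongr
    have h4 : D / 4 * (D / 4) ≤ (X.card : ℝ) * (D / 4) := by gcongr
    have h5 : n ^ 2 / (2 ^ 6 * k ^ 2) = D ^ 2 / 64 := by rw [hD]; field_simp; norm_num
    rw [hcount, hcomm, h5]
    nlinarith [sq_nonneg D]
  · intro a ha b hb
    refine le_trans ?_ (paths_of_few_poorPartners R B s t (s / 4) X hX (by linarith) ha hb)
    calc n ^ 2 / (2 ^ 24 * k ^ 7) ≤ s / 2 * (t / 2) := by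
          have : s / 2 * (t / 2) = n ^ 2 / (2 ^ 21 * k ^ 6) := by
            rw [hs, ht, hD]; field_simp; norm_num
          rw [this]
          gcongr <;> first | exact hk | norm_num
      _ ≤ _ := by
          gcongr
          · linarith
          · linarith
          · linarith

/-- Theorem 3: for every bipartite graph `G` with classes `A`, `B`, with
`n ≥ 2^18 k^5` vertices and at least `n²/k` edges, there are `A' ⊆ A` and `B' ⊆ B`
such that the subgraph induced by `A' ∪ B'` has at least `n²/(2^6 k²)` edges and for
every `a ∈ A'`, `b ∈ B'` there are at least `n²/(2^24 k^7)` paths of length three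
between `a` and `b` inside it. -/
theorem stmt_9 {V : Type} [Fintype V] (k : ℝ) (hk : 0 < k) (n : ℕ)
    (G : SimpleGraph V) (A B : Finset V) (hdisj : Disjoint A B)
    (hbip : ∀ u v : V, G.Adj u v → (u ∈ A ∧ v ∈ B) ∨ (u ∈ B ∧ v ∈ A))
    (hn : n = A.card + B.card) (hnk : 2 ^ 18 * k ^ 5 ≤ (n : ℝ))
    (hedges : (n : ℝ) ^ 2 / k ≤ (G.edgeSet.ncard : ℝ)) :
    ∃ A' ⊆ A, ∃ B' ⊆ B,
      (n : ℝ) ^ 2 / (2 ^ 6 * k ^ 2) ≤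
        (({e ∈ G.edgeSet | ∃ a b : V, a ∈ A' ∧ b ∈ B' ∧ e = s(a, b)}).ncard : ℝ) ∧
      ∀ a ∈ A', ∀ b ∈ B',
        (n : ℝ) ^ 2 / (2 ^ 24 * k ^ 7) ≤
          (({p : V × V | p.1 ∈ B' ∧ p.2 ∈ A' ∧ p.1 ≠ b ∧ p.2 ≠ a ∧
              G.Adj a p.1 ∧ G.Adj p.1 p.2 ∧ G.Adj p.2 b}).ncard : ℝ) := by
  classical
  have hadj : ∀ a b : V, a ∈ A → b ∈ A → ¬ G.Adj a b := fun a b ha hb h => by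
    rcases hbip a b h with h | h
    · exact Finset.disjoint_left.mp hdisj hb h.2
    · exact Finset.disjoint_left.mp hdisj ha h.1
  have hinj : ∀ X ⊆ A, ∀ Y ⊆ B,
      ({e ∈ G.edgeSet | ∃ a b : V, a ∈ X ∧ b ∈ Y ∧ e = s(a, b)}).ncard =
        ({p ∈ X ×ˢ Y | G.Adj p.1 p.2}).card := by
    intro X hX Y hY
    rw [← Set.ncard_coe_finset, ← Set.InjOn.ncard_image (f := fun p : V × V => s(p.1, p.2))]
    · congr 1
      ext e
      simp only [Set.mem_ofPred_eq, Set.mem_image, Finset.mem_coe, Finset.mem_filter,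
        Finset.mem_product, Prod.exists]
      constructor
      · rintro ⟨he, a, b, ha, hb, rfl⟩
        exact ⟨a, b, ⟨⟨ha, hb⟩, he⟩, rfl⟩
      · rintro ⟨a, b, ⟨⟨ha, hb⟩, he⟩, rfl⟩
        exact ⟨he, a, b, ha, hb, rfl⟩
    · rintro ⟨a, b⟩ h ⟨a', b'⟩ h' he
      simp only [Finset.coe_filter, Finset.mem_product, Set.mem_ofPred_eq] at h h'
      rcases Sym2.eq_iff.mp he with ⟨rfl, rfl⟩ | ⟨rfl, rfl⟩
      · rfl
      · exact absurd (hY h'.1.2) (Finset.disjoint_left.mp hdisj (hX h.1.1))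
  have hedge : G.edgeSet.ncard = ({p ∈ A ×ˢ B | G.Adj p.1 p.2}).card := by
    rw [← hinj A subset_rfl B subset_rfl]
    congr 1
    ext e
    induction e with | h u v =>
    simp only [Set.mem_ofPred_eq, SimpleGraph.mem_edgeSet]
    refine ⟨fun h => ⟨h, ?_⟩, fun h => h.1⟩
    rcases hbip u v h with ⟨hu, hv⟩ | ⟨hu, hv⟩
    · exact ⟨u, v, hu, hv, rfl⟩
    · exact ⟨v, u, hv, hu, Sym2.eq_swap⟩
  have hAn : (A.card : ℝ) ≤ n := by exact_mod_cast (by omega : A.card ≤ n)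
  have hBn : (B.card : ℝ) ≤ n := by exact_mod_cast (by omega : B.card ≤ n)
  have hn0 : (0 : ℝ) < n := lt_of_lt_of_le (by positivity) hnk
  rw [hedge] at hedges
  have hk1 : 1 ≤ k := by
    have h1 : (({p ∈ A ×ˢ B | G.Adj p.1 p.2}).card : ℝ) ≤ (A.card : ℝ) * B.card := by
      exact_mod_cast (Finset.card_filter_le _ _).trans (Finset.card_product A B).le
    have h2 : (A.card : ℝ) * B.card ≤ n ^ 2 := by
      rw [sq]
      gcongr
    have h3 := hedges.trans (h1.trans h2)
    rw [div_le_iff₀ hk] at h3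
    exact (le_mul_iff_one_le_right (by positivity)).mp h3
  obtain ⟨X, hX, Y, hY, he, hp⟩ :=
    exists_dense_three_path_connected G.Adj A B k n hk1 hAn hBn hnk hedges
  refine ⟨X, hX, Y, hY, by rwa [hinj X hX Y hY], fun a ha b hb => (hp a ha b hb).trans ?_⟩
  rw [← Set.ncard_coe_finset]
  refine Nat.cast_le.mpr (Set.ncard_le_ncard ?_ (Set.toFinite _))
  rintro ⟨b₁, a₁⟩ h
  simp only [Finset.coe_filter, Finset.mem_product, Set.mem_ofPred_eq] at h ⊢
  exact ⟨h.1.1, h.1.2, h.2.1, h.2.2.1, h.2.2.2.1, h.2.2.2.2.1.symm, h.2.2.2.2.2⟩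
end
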